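/- Let p ∈ {5, 7, 11, 13, 17, 19, 23, 29, 31, 41, 47, 59, 71} (the primes p > 3 for which Γ₀⁺(p) has genus zero) and let k > 2 be an even integer. Let S_k⁺(p) be the space of weight-k cusp forms f for Γ₀(p) satisfying additionally f(−1/(pτ)) = p^{k/2}·τ^k·f(τ) for all τ ∈ ℍ. Then dim S_k⁺(p) = ((p+5)/6)·⌊k/4⌋ + ⌊k/3⌋ − k/2 if p ≡ 1 or 7 (mod 12), and dim S_k⁺(p) = ((p+13)/6)·⌊k/4⌋ − k/2 if p ≡ 5 or 11 (mod 12). Moreover the corresponding space M_k⁺(p) of modular forms (holomorphic at the cusps but not required to vanish there) satisfies dim M_k⁺(p) = 1 + dim S_k⁺(p). -/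

import Mathlib

open Matrix CongruenceSubgroup UpperHalfPlane
open scoped MatrixGroups

/-- `S_k⁺(p)`: the subspace of weight-`k` cusp forms for `Γ₀(p)` that additionally satisfy
the Fricke relation `f(−1/(pτ)) = p^{k/2} τ^k f(τ)` for all `τ ∈ ℍ` (forms for the Fricke
group `Γ₀⁺(p)`).  Here the point `−1/(pτ) ∈ ℍ` is encoded as any `w : ℍ` whose coercion to
`ℂ` equals `−1/(pτ)`, and (for even `k`) `p^{k/2}` uses the integer `k/2`. -/
noncomputable def frickeCuspForms (p : ℕ) (k : ℤ) : Submodule ℂ (CuspForm (Gamma0 p) k) where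
  carrier := {f | ∀ τ w : ℍ, (w : ℂ) = -1 / ((p : ℂ) * (τ : ℂ)) →
    f w = (p : ℂ) ^ (k / 2) * (τ : ℂ) ^ k * f τ}
  zero_mem' := by
    intro τ w _
    simp
  add_mem' := by
    intro f g hf hg τ w hw
    simp only [CuspForm.add_apply, hf τ w hw, hg τ w hw]
    ring
  smul_mem' := by
    intro c f hf τ w hw
    simp only [CuspForm.smul_apply, hf τ w hw, smul_eq_mul]
    ring

/-- `M_k⁺(p)`: the subspace of weight-`k` modular forms for `Γ₀(p)` (holomorphic at the
cusps but not required to vanish there) that additionally satisfy the Fricke relation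
`f(−1/(pτ)) = p^{k/2} τ^k f(τ)` for all `τ ∈ ℍ`. -/
noncomputable def frickeModularForms (p : ℕ) (k : ℤ) :
    Submodule ℂ (ModularForm (Gamma0 p) k) where
  carrier := {f | ∀ τ w : ℍ, (w : ℂ) = -1 / ((p : ℂ) * (τ : ℂ)) →
    f w = (p : ℂ) ^ (k / 2) * (τ : ℂ) ^ k * f τ}
  zero_mem' := by
    intro τ w _
    simp
  add_mem' := by
    intro f g hf hg τ w hw
    simp only [ModularForm.add_apply, hf τ w hw, hg τ w hw]
    ring
  smul_mem' := by
    intro c f hf τ w hw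
    simp only [ModularForm.smul_apply, hf τ w hw, smul_eq_mul]
    ring

section Orders

open PowerSeries

/-- `W` contains a power series of order exactly `i`. -/
def HasOrder {K : Type*} [Field K] (W : Submodule K K⟦X⟧) (i : ℕ) : Prop :=
  ∃ F ∈ W, F.order = (i : ℕ∞)

theorem hasOrder_iff {K : Type*} [Field K] {W : Submodule K K⟦X⟧} {i : ℕ} :
    HasOrder W i ↔ ∃ F ∈ W, coeff i F ≠ 0 ∧ ∀ j < i, coeff j F = 0 := by
  simp only [HasOrder, order_eq_nat]

theorem HasOrder.mul {K : Type*} [Field K] {V W U : Submodule K K⟦X⟧} {i j : ℕ}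
    (hV : HasOrder V i) (hW : HasOrder W j) (hU : ∀ F ∈ V, ∀ G ∈ W, F * G ∈ U) :
    HasOrder U (i + j) := by
  obtain ⟨F, hF, hi⟩ := hV
  obtain ⟨G, hG, hj⟩ := hW
  exact ⟨F * G, hU F hF G hG, by rw [order_mul, hi, hj]; push_cast; rfl⟩

/-- The dimension of a space of power series is the number of orders of its nonzero elements. -/
theorem finrank_eq_card_of_hasOrder {K : Type*} [Field K] (W : Submodule K K⟦X⟧) (S : Finset ℕ)
    (hS : ∀ i, HasOrder W i ↔ i ∈ S) : Module.finrank K W = S.card := by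
  let φ : W →ₗ[K] (S → K) := LinearMap.pi fun i => (coeff (i : ℕ)).comp W.subtype
  have hφ : ∀ F i, φ F i = coeff (i : ℕ) (F : K⟦X⟧) := fun _ _ => rfl
  have hinj : Function.Injective φ := by
    rw [← LinearMap.ker_eq_bot, LinearMap.ker_eq_bot']
    intro F hF
    by_contra hne
    have hne' : (F : K⟦X⟧) ≠ 0 := fun h => hne (Subtype.ext h)
    have hord : (F : K⟦X⟧).order = ((F : K⟦X⟧).order.toNat : ℕ∞) :=
      (ENat.natCast_toNat (by simpa [order_eq_top] using hne')).symm
    have hmem := (hS _).1 ⟨F, F.2, hord⟩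
    exact ((order_eq_nat.1 hord).1) (by simpa [hφ] using congrFun hF ⟨_, hmem⟩)
  have hfin : Module.Finite K W := Module.Finite.of_injective φ hinj
  have hle : Module.finrank K W ≤ S.card := by
    simpa using LinearMap.finrank_le_finrank_of_injective hinj
  have hex : ∀ i : S, ∃ F : W, coeff (i : ℕ) (F : K⟦X⟧) ≠ 0 ∧
      ∀ j < (i : ℕ), coeff j (F : K⟦X⟧) = 0 := fun i => by
    obtain ⟨F, hF, h⟩ := hasOrder_iff.1 ((hS i).2 i.2)
    exact ⟨⟨F, hF⟩, h⟩
  choose F hF using hex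
  have hdet : (Matrix.of fun i j : S => coeff (j : ℕ) (F i : K⟦X⟧)).det ≠ 0 := by
    rw [Matrix.det_of_isUpperTriangular]
    · exact Finset.prod_ne_zero_iff.2 fun i _ => (hF i).1
    · intro i j hij
      exact (hF i).2 j hij
  have hli : LinearIndependent K F := by
    refine LinearIndependent.of_comp φ ?_
    exact Matrix.linearIndependent_rows_of_det_ne_zero hdet
  refine le_antisymm hle ?_
  simpa using hli.fintype_card_le_finrank

end Orders

section Counting

/-- The largest order of vanishing in half-weight `m ≥ 2`, in terms of the largest orders
`a`, `b`, `c` in half-weights `2`, `3`, `6`. -/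
def maxOrder (a b c m : ℕ) : ℕ :=
  if m % 6 = 0 then m / 6 * c
  else if m % 6 = 1 then m / 6 * c - 1
  else if m % 6 = 2 then m / 6 * c + a
  else if m % 6 = 3 then m / 6 * c + b
  else if m % 6 = 4 then m / 6 * c + 2 * a
  else m / 6 * c + a + b

theorem maxOrder_add_six (a b c m : ℕ) (hm : 2 ≤ m) (hc : 0 < c) :
    maxOrder a b c (m + 6) = maxOrder a b c m + c := by
  have h1 : (m + 6) % 6 = m % 6 := by omega
  have h2 : (m + 6) / 6 = m / 6 + 1 := by omega
  have h3 : m % 6 = 1 → 1 ≤ m / 6 * c := fun h => Nat.mul_pos (by omega) hc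
  unfold maxOrder
  rw [h1, h2, add_mul, one_mul]
  split_ifs <;> grind

theorem maxOrder_dual {a b c m d : ℕ} (hm : 2 ≤ m) (hmd : m + 2 ≤ 12 * d + 1) (hc : 0 < c)
    (habc : 2 * a + b + 1 = c) :
    maxOrder a b c m + maxOrder a b c (12 * d + 1 - m) + 1 = d * (2 * c) := by
  have key : ∀ s t u : ℕ, s + t = u → s * c + t * c = u * c := fun s t u h => by
    rw [← add_mul, h]
  have hpos : ∀ s : ℕ, 0 < s → 0 < s * c := fun s hs => Nat.mul_pos hs hc
  have hd : d * (2 * c) = (2 * d) * c := by ring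
  rw [hd]
  obtain ⟨n, hn⟩ : ∃ n, n = 12 * d + 1 - m := ⟨_, rfl⟩
  rw [← hn]
  have e1 : m = 6 * (m / 6) + m % 6 := by omega
  have e2 : n = 6 * (n / 6) + n % 6 := by omega
  have h6 : m % 6 < 6 := Nat.mod_lt _ (by norm_num)
  have hsum : m + n = 12 * d + 1 := by omega
  have hlast : (2 * d - 1) * c + c = 2 * d * c := by
    rw [← Nat.succ_mul]; congr 1; omega
  unfold maxOrder
  have hm6 : m % 6 = 0 ∨ m % 6 = 1 ∨ m % 6 = 2 ∨ m % 6 = 3 ∨ m % 6 = 4 ∨ m % 6 = 5 := by omega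
  rcases hm6 with h | h | h | h | h | h
  · have h' : n % 6 = 1 := by omega
    have := key (m / 6) (n / 6) (2 * d) (by omega)
    have := hpos (n / 6) (by omega)
    simp only [h, h']; norm_num; omega
  · have h' : n % 6 = 0 := by omega
    have := key (m / 6) (n / 6) (2 * d) (by omega)
    have := hpos (m / 6) (by omega)
    simp only [h, h']; norm_num; omega
  · have h' : n % 6 = 5 := by omega
    have := key (m / 6) (n / 6) (2 * d - 1) (by omega)
    simp only [h, h']; norm_num; omega
  · have h' : n % 6 = 4 := by omega
    have := key (m / 6) (n / 6) (2 * d - 1) (by omega)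
    simp only [h, h']; norm_num; omega
  · have h' : n % 6 = 3 := by omega
    have := key (m / 6) (n / 6) (2 * d - 1) (by omega)
    simp only [h, h']; norm_num; omega
  · have h' : n % 6 = 2 := by omega
    have := key (m / 6) (n / 6) (2 * d - 1) (by omega)
    simp only [h, h']; norm_num; omega

/-- The orders occurring in a graded ring of forms, from the orders in half-weights `2`, `3`, `6`,
division by a form of half-weight `12` and order `2 * c`, and a duality constraint coming from
half-weight `1`. -/
theorem order_iff_le_maxOrder (H : ℕ → ℕ → Prop) {a b c : ℕ} (habc : 2 * a + b + 1 = c)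
    (hmul : ∀ m n i j, H m i → H n j → H (m + n) (i + j))
    (hdiv : ∀ m i, H (m + 12) (i + 2 * c) → H m i) (hone : ¬ H 1 0)
    (h2 : ∀ i ≤ a, H 2 i) (h3 : ∀ i ≤ b, H 3 i) (h6 : ∀ i ≤ c, H 6 i)
    {m : ℕ} (hm : 2 ≤ m) (i : ℕ) : H m i ↔ i ≤ maxOrder a b c m := by
  have hc : 0 < c := by omega
  have hadd : ∀ {m n s t : ℕ}, (∀ i ≤ s, H m i) → (∀ i ≤ t, H n i) →
      ∀ i ≤ s + t, H (m + n) i := by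
    intro m n s t hs ht i hi
    have h := hmul m n (min i s) (i - min i s) (hs _ (min_le_right _ _)) (ht _ (by omega))
    rwa [show min i s + (i - min i s) = i by omega] at h
  have hlow : ∀ m, 2 ≤ m → ∀ i ≤ maxOrder a b c m, H m i := by
    intro m
    induction m using Nat.strong_induction_on with
    | _ m ih =>
      intro hm i hi
      by_cases h : m < 8
      · interval_cases m <;> simp [maxOrder] at hi
        · exact h2 i hi
        · exact h3 i hi
        · exact hadd h2 h2 i (by omega)
        · exact hadd h2 h3 i (by omega)
        · exact h6 i hi
        · exact hadd (hadd h2 h2) h3 i (by omega)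
      · obtain ⟨n, rfl⟩ : ∃ n, m = n + 6 := ⟨m - 6, by omega⟩
        rw [maxOrder_add_six a b c n (by omega) hc] at hi
        exact hadd (ih n (by omega) (by omega)) h6 i hi
  have hdivs : ∀ d, ¬ H (12 * d + 1) (d * (2 * c)) := by
    intro d
    induction d with
    | zero => simpa using hone
    | succ d ih =>
      intro h
      refine ih (hdiv _ _ ?_)
      convert h using 1 <;> ring
  refine ⟨fun h => ?_, hlow m hm i⟩
  by_contra hlt
  rw [not_le] at hlt
  obtain ⟨d, hd⟩ : ∃ d, d = i + m := ⟨_, rfl⟩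
  have hdual := maxOrder_dual (d := d) hm (by omega) hc habc
  have hdc : d ≤ d * (2 * c) := Nat.le_mul_of_pos_right _ (by omega)
  have hother := hlow (12 * d + 1 - m) (by omega) (d * (2 * c) - i) (by omega)
  refine hdivs d ?_
  have := hmul _ _ _ _ h hother
  rwa [show m + (12 * d + 1 - m) = 12 * d + 1 by omega,
    show i + (d * (2 * c) - i) = d * (2 * c) by omega] at this

end Counting

namespace Packed

open PowerSeries

/-- The base in which power series modulo `modulus` are packed into natural numbers. -/
def base : ℕ := 2 ^ 64

/-- The prime modulo which the elimination is carried out. -/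
def modulus : ℕ := 10007

/-- The natural number with the `n` digits `a i mod modulus` in base `base`. -/
def packFn (a : ℕ → ℤ) : ℕ → ℕ
  | 0 => 0
  | n + 1 => packFn a n + (a n % (modulus : ℤ)).toNat * base ^ n

/-- Reduce the first `n` digits modulo `modulus` and drop the others. -/
def normalize : ℕ → ℕ → ℕ
  | 0, _ => 0
  | n + 1, N => N % base % modulus + base * normalize n (N / base)

/-- The sum of the `k`-th powers of the divisors of `n` that are at most the last argument. -/
def divisorPowSum (k n : ℕ) : ℕ → ℕ
  | 0 => 0
  | d + 1 => divisorPowSum k n d + if n % (d + 1) = 0 then (d + 1) ^ k else 0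

/-- The coefficients of `u f(τ) + v f(pτ)` for the series `f = 1 + e ∑ σ_k(i) q ^ i`. -/
def eisensteinCoeff (p k : ℕ) (e u v : ℤ) (i : ℕ) : ℤ :=
  if i = 0 then u + v
  else e * (u * (divisorPowSum k i i : ℤ) +
    v * if i % p = 0 then (divisorPowSum k (i / p) (i / p) : ℤ) else 0)

/-- Generating forms, given by their half-weight, sign and coefficients. -/
def generators (p : ℕ) : List (ℕ × ℕ × (ℕ → ℤ)) :=
  [(1, 1, eisensteinCoeff p 1 (-24) (-1) p),
   (2, 0, eisensteinCoeff p 3 240 1 (p ^ 2)),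
   (2, 1, eisensteinCoeff p 3 240 1 (-p ^ 2)),
   (3, 0, eisensteinCoeff p 5 (-504) 1 (p ^ 3)),
   (3, 1, eisensteinCoeff p 5 (-504) 1 (-p ^ 3))]

/-- Multiply `f` by powers of a generator and continue with `rest`. -/
def monomialsStep (n w t N : ℕ) (rest : ℕ → ℕ → ℕ → List ℕ) : ℕ → ℕ → ℕ → ℕ → List ℕ
  | 0, m, s, f => rest m s f
  | c + 1, m, s, f => rest m s f ++
      if w ≤ m then monomialsStep n w t N rest c (m - w) (s + t) (normalize n (f * N)) else []

/-- All packed products of `f` with monomials of half-weight `m` in the generators for which the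
total sign is even. -/
def monomials (n : ℕ) : List (ℕ × ℕ × ℕ) → ℕ → ℕ → ℕ → List ℕ
  | [], m, s, f => if m = 0 ∧ s % 2 = 0 then [f] else []
  | g :: gs, m, s, f => monomialsStep n g.1 g.2.1 g.2.2 (monomials n gs) m m s f

/-- Clear the pivot digits of `r` by adding multiples of the given rows. -/
def reduceRow (r : ℕ) : List (ℕ × ℕ) → ℕ
  | [] => r
  | q :: l => reduceRow (r + (modulus - r / q.1 % base % modulus) * q.2) l

/-- The power of `base` at the first nonzero digit of `r`. -/
def pivot (r : ℕ) : ℕ → ℕ → ℕ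
  | 0, b => b
  | c + 1, b => if r % (b * base) = 0 then pivot r c (b * base) else b

/-- Gaussian elimination on packed rows. -/
def eliminate (n : ℕ) : List ℕ → List (ℕ × ℕ) → List (ℕ × ℕ)
  | [], acc => acc
  | r :: l, acc =>
    let r' := normalize n (reduceRow r acc)
    if r' = 0 then eliminate n l acc else
    let b := pivot r' n 1
    let c := (r' / b % base) ^ (modulus - 2) % modulus
    eliminate n l (acc ++ [(b, normalize n (c * r'))])

/-- Every order less than `n` occurs among the given rows. -/
def allPivots (n : ℕ) (l : List (ℕ × ℕ)) : Bool :=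
  (List.range n).all fun i => l.any fun q => q.2 % base ^ (i + 1) = base ^ i

/-- Modulo `modulus`, the monomials of half-weight `m` in the generators attain all orders less
than `n`. -/
def rankCheck (p m n : ℕ) : Bool :=
  allPivots n (eliminate n ((monomials n
    ((generators p).map fun g => (g.1, g.2.1, packFn g.2.2 n)) m 0 1).take (n + 9)) [])

theorem packFn_eq_sum (a : ℕ → ℤ) (n : ℕ) :
    packFn a n = ∑ i ∈ Finset.range n, (a i % (modulus : ℤ)).toNat * base ^ i := by
  induction n with
  | zero => rfl
  | succ n ih => rw [packFn, ih, Finset.sum_range_succ]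

theorem base_pos : 0 < base := by simp [base]

theorem digit_lt (a : ℤ) : (a % (modulus : ℤ)).toNat < modulus := by
  have h0 : (0 : ℤ) < (modulus : ℤ) := by simp [modulus]
  have h1 := Int.emod_lt_of_pos a h0
  omega

theorem digit_cast (a : ℤ) : ((a % (modulus : ℤ)).toNat : ZMod modulus) = (a : ZMod modulus) := by
  have h : (((a % (modulus : ℤ)).toNat : ℤ) : ZMod modulus) =
      ((a % (modulus : ℤ) : ℤ) : ZMod modulus) := by
    rw [Int.toNat_of_nonneg (Int.emod_nonneg _ (by simp [modulus]))]
  rw [← ZMod.intCast_mod a modulus, ← h, Int.cast_natCast]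

theorem digit_eq_of_cast {d : ℕ} {a : ℤ} (h : (d : ZMod modulus) = (a : ZMod modulus)) :
    d % modulus = (a % (modulus : ℤ)).toNat := by
  have h1 : ((d : ℤ) : ZMod modulus) = (a : ZMod modulus) := by simpa using h
  rw [ZMod.intCast_eq_intCast_iff'] at h1
  omega

theorem digit_of_sum {d : ℕ → ℕ} (hd : ∀ k, d k < base) {j n : ℕ} (hj : j < n) :
    (∑ k ∈ Finset.range n, d k * base ^ k) / base ^ j % base = d j := by
  induction j generalizing d n with
  | zero =>
    obtain ⟨n, rfl⟩ : ∃ m, n = m + 1 := ⟨n - 1, by omega⟩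
    rw [Finset.sum_range_succ']
    have : ∑ k ∈ Finset.range n, d (k + 1) * base ^ (k + 1) =
        base * ∑ k ∈ Finset.range n, d (k + 1) * base ^ k := by
      rw [Finset.mul_sum]; exact Finset.sum_congr rfl fun _ _ => by ring
    rw [this]
    simp [Nat.mod_eq_of_lt (hd 0)]
  | succ j ih =>
    obtain ⟨n, rfl⟩ : ∃ m, n = m + 1 := ⟨n - 1, by omega⟩
    rw [Finset.sum_range_succ']
    have : ∑ k ∈ Finset.range n, d (k + 1) * base ^ (k + 1) =
        base * ∑ k ∈ Finset.range n, d (k + 1) * base ^ k := by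
      rw [Finset.mul_sum]; exact Finset.sum_congr rfl fun _ _ => by ring
    rw [this, pow_succ', ← Nat.div_div_eq_div_mul, pow_zero, mul_one,
      Nat.mul_add_div base_pos, Nat.div_eq_of_lt (hd 0), add_zero]
    exact ih (d := fun k => d (k + 1)) (fun k => hd (k + 1)) (by omega)

theorem normalize_eq {n N : ℕ} {d : ℕ → ℕ} (hd : ∀ k < n, d k < base)
    (hN : N ≡ ∑ k ∈ Finset.range n, d k * base ^ k [MOD base ^ n]) :
    normalize n N = ∑ k ∈ Finset.range n, d k % modulus * base ^ k := by
  induction n generalizing N d with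
  | zero => rfl
  | succ n ih =>
    have hs : ∀ e : ℕ → ℕ, ∑ k ∈ Finset.range (n + 1), e k * base ^ k =
        e 0 + base * ∑ k ∈ Finset.range n, e (k + 1) * base ^ k := by
      intro e
      rw [Finset.sum_range_succ', Finset.mul_sum, add_comm]
      simp only [pow_zero, mul_one]
      exact congrArg _ (Finset.sum_congr rfl fun _ _ => by ring)
    rw [hs] at hN ⊢
    have h0 : N % base = d 0 := by
      have := hN.of_dvd (dvd_pow_self base n.succ_ne_zero)
      rw [Nat.ModEq, Nat.add_mul_mod_self_left, Nat.mod_eq_of_lt (hd 0 n.succ_pos)] at this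
      exact this
    rw [normalize, h0]
    congr 2
    refine ih (fun k hk => hd (k + 1) (by omega)) ?_
    rw [← Nat.mod_add_div N base, h0, pow_succ'] at hN
    have := Nat.ModEq.add_left_cancel' _ hN
    exact Nat.ModEq.mul_left_cancel' base_pos.ne' this

/-- The packed form of a power series with integer coefficients. -/
noncomputable def pack (n : ℕ) (F : ℤ⟦X⟧) : ℕ := packFn (fun i => coeff i F) n

/-- `N` has digits at most `t * modulus ^ 2` congruent to the coefficients of `F`. -/
def Represents (n t N : ℕ) (F : ℤ⟦X⟧) : Prop :=
  ∃ d : ℕ → ℕ, (∀ k, d k ≤ t * modulus ^ 2) ∧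
    (∀ k < n, (d k : ZMod modulus) = ((coeff k F : ℤ) : ZMod modulus)) ∧
    N ≡ ∑ k ∈ Finset.range n, d k * base ^ k [MOD base ^ n]

theorem Represents.normalize_eq {n t N : ℕ} {F : ℤ⟦X⟧} (h : Represents n t N F) (ht : t ≤ 1001) :
    normalize n N = pack n F := by
  obtain ⟨d, hd, hF, hN⟩ := h
  rw [Packed.normalize_eq (fun k _ => (hd k).trans_lt ?_) hN, pack, packFn_eq_sum]
  · refine Finset.sum_congr rfl fun k hk => ?_
    rw [digit_eq_of_cast (hF k (Finset.mem_range.1 hk))]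
  · calc t * modulus ^ 2 ≤ 1001 * modulus ^ 2 := Nat.mul_le_mul_right _ ht
      _ < base := by norm_num [modulus, base]

theorem represents_pack (n : ℕ) (F : ℤ⟦X⟧) : Represents n 1 (pack n F) F := by
  refine ⟨fun k => (coeff k F % (modulus : ℤ)).toNat, fun k => ?_, fun k _ => digit_cast _, ?_⟩
  · have := digit_lt (coeff k F)
    dsimp only
    nlinarith
  · rw [pack, packFn_eq_sum]

theorem Represents.add_mul_pack {n t N : ℕ} {F : ℤ⟦X⟧} (h : Represents n t N F) (G : ℤ⟦X⟧) {c : ℕ}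
    (hc : c ≤ modulus) : Represents n (t + 1) (N + c * pack n G) (F + c • G) := by
  obtain ⟨d, hd, hF, hN⟩ := h
  refine ⟨fun k => d k + c * (coeff k G % (modulus : ℤ)).toNat, fun k => ?_, fun k hk => ?_, ?_⟩
  · have h1 := hd k
    have h2 : c * (coeff k G % (modulus : ℤ)).toNat ≤ modulus * modulus :=
      Nat.mul_le_mul hc (digit_lt _).le
    dsimp only
    nlinarith
  · push_cast
    rw [hF k hk, digit_cast]
    simp [-nsmul_eq_mul]
  · rw [pack, packFn_eq_sum, Finset.mul_sum]
    simp only [add_mul, Finset.sum_add_distrib, mul_assoc]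
    exact hN.add_right _

theorem represents_mul_pack {n : ℕ} (hn : n ≤ 1000) (F G : ℤ⟦X⟧) :
    Represents n 1000 (pack n F * pack n G) (F * G) := by
  let f : ℕ → ℕ := fun k => (coeff k F % (modulus : ℤ)).toNat
  let g : ℕ → ℕ := fun k => (coeff k G % (modulus : ℤ)).toNat
  let d : ℕ → ℕ := fun k =>
    if k < n then ∑ x ∈ Finset.HasAntidiagonal.antidiagonal k, f x.1 * g x.2 else 0
  refine ⟨d, fun k => ?_, fun k hk => ?_, ?_⟩
  · by_cases hk : k < n
    · simp only [d, if_pos hk]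
      have h1 : ∀ x ∈ Finset.HasAntidiagonal.antidiagonal k,
          f x.1 * g x.2 ≤ modulus ^ 2 := fun x _ => by
        rw [sq]; exact Nat.mul_le_mul (digit_lt _).le (digit_lt _).le
      refine (Finset.sum_le_card_nsmul _ _ _ h1).trans ?_
      rw [Finset.Nat.card_antidiagonal, smul_eq_mul]
      exact Nat.mul_le_mul_right _ (by omega)
    · simp only [d, if_neg hk]
      exact Nat.zero_le _
  · simp only [d, if_pos hk, coeff_mul]
    push_cast
    refine Finset.sum_congr rfl fun x _ => ?_
    rw [digit_cast, digit_cast]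
  · let P : Polynomial ℕ := ∑ i ∈ Finset.range n, Polynomial.monomial i (f i)
    let Q : Polynomial ℕ := ∑ i ∈ Finset.range n, Polynomial.monomial i (g i)
    have hP : P.eval base = pack n F := by
      simp [P, Polynomial.eval_finsetSum, pack, packFn_eq_sum, f]
    have hQ : Q.eval base = pack n G := by
      simp [Q, Polynomial.eval_finsetSum, pack, packFn_eq_sum, g]
    have hPc : ∀ k < n, P.coeff k = f k := fun k hk => by
      simp [P, Polynomial.coeff_monomial, hk]
    have hQc : ∀ k < n, Q.coeff k = g k := fun k hk => by
      simp [Q, Polynomial.coeff_monomial, hk]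
    rw [← hP, ← hQ, ← Polynomial.eval_mul,
      Polynomial.eval_eq_sum_range' (n := n + ((P * Q).natDegree + 1)) (by omega),
      Finset.sum_range_add]
    have h0 : ∑ k ∈ Finset.range n, (P * Q).coeff k * base ^ k =
        ∑ k ∈ Finset.range n, d k * base ^ k := by
      refine Finset.sum_congr rfl fun k hk => ?_
      have hk := Finset.mem_range.1 hk
      simp only [d, if_pos hk, Polynomial.coeff_mul]
      congr 1
      refine Finset.sum_congr rfl fun x hx => ?_
      have := Finset.HasAntidiagonal.mem_antidiagonal.1 hx
      rw [hPc _ (by omega), hQc _ (by omega)]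
    rw [h0]
    have h1 : base ^ n ∣ ∑ x ∈ Finset.range ((P * Q).natDegree + 1),
        (P * Q).coeff (n + x) * base ^ (n + x) :=
      Finset.dvd_sum fun x _ => Dvd.dvd.mul_left (pow_dvd_pow _ (by omega)) _
    exact (Nat.ModEq.refl _).add (Nat.modEq_zero_iff_dvd.2 h1)

theorem normalize_mul_pack {n : ℕ} (hn : n ≤ 1000) (F G : ℤ⟦X⟧) :
    normalize n (pack n F * pack n G) = pack n (F * G) :=
  (represents_mul_pack hn F G).normalize_eq (by norm_num)

/-- The packed forms of the members of `W`. -/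
def PackedIn (n : ℕ) (W : AddSubgroup ℤ⟦X⟧) (N : ℕ) : Prop := ∃ F ∈ W, N = pack n F

theorem represents_reduceRow {n : ℕ} {W : AddSubgroup ℤ⟦X⟧} (l : List (ℕ × ℕ))
    (hl : ∀ q ∈ l, PackedIn n W q.2) {r t : ℕ} (hr : ∃ F ∈ W, Represents n t r F) :
    ∃ F ∈ W, Represents n (t + l.length) (reduceRow r l) F := by
  induction l generalizing r t with
  | nil => exact hr
  | cons q l ih =>
    obtain ⟨F, hF, hr⟩ := hr
    obtain ⟨G, hG, hq⟩ := hl q (by simp)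
    rw [reduceRow, List.length_cons, show t + (l.length + 1) = (t + 1) + l.length by omega]
    refine ih (fun q' h' => hl q' (by simp [h'])) ⟨_, W.add_mem hF (W.nsmul_mem hG
      (modulus - r / q.1 % base % modulus)), ?_⟩
    rw [hq]
    exact hr.add_mul_pack G (Nat.sub_le _ _)

theorem packedIn_eliminate {n : ℕ} {W : AddSubgroup ℤ⟦X⟧} (l : List ℕ)
    (hl : ∀ r ∈ l, PackedIn n W r) (acc : List (ℕ × ℕ)) (hacc : ∀ q ∈ acc, PackedIn n W q.2)
    (hlen : acc.length + l.length ≤ 1000) : ∀ q ∈ eliminate n l acc, PackedIn n W q.2 := by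
  induction l generalizing acc with
  | nil => exact hacc
  | cons r l ih =>
    simp only [List.length_cons] at hlen
    have hl' : ∀ r ∈ l, PackedIn n W r := fun r' h' => hl r' (by simp [h'])
    rw [eliminate]
    dsimp only
    obtain ⟨F, hF, hr⟩ := hl r (by simp)
    obtain ⟨G, hG, hrow⟩ := represents_reduceRow acc hacc ⟨F, hF, hr ▸ represents_pack n F⟩
    rw [hrow.normalize_eq (by omega)]
    split_ifs
    · exact ih hl' acc hacc (by omega)
    · refine ih hl' _ (fun q hq => ?_) (by simp; omega)
      rw [List.mem_append, List.mem_singleton] at hq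
      rcases hq with hq | rfl
      · exact hacc q hq
      · set c := (pack n G / pivot (pack n G) n 1 % base) ^ (modulus - 2) % modulus
        have hc : c ≤ modulus := (Nat.mod_lt _ (by norm_num [modulus])).le
        have h0 : Represents n 1 0 0 :=
          ⟨fun _ => 0, fun _ => Nat.zero_le _, fun _ _ => by simp, by simp; rfl⟩
        have h1 := (h0.add_mul_pack G hc).normalize_eq (by norm_num)
        simp only [zero_add] at h1
        exact ⟨_, W.nsmul_mem hG c, h1⟩

/-- A graded family of groups of power series, with a parity. -/
structure IsGraded (G : ℕ → ℕ → AddSubgroup ℤ⟦X⟧) : Prop where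
  one_mem : 1 ∈ G 0 0
  mul_mem : ∀ {m s m' s' E F}, E ∈ G m s → F ∈ G m' s' → E * F ∈ G (m + m') (s + s')
  even : ∀ {m s F}, F ∈ G m s → s % 2 = 0 → F ∈ G m 0

theorem packedIn_monomials {n M : ℕ} (hn : n ≤ 1000) {G : ℕ → ℕ → AddSubgroup ℤ⟦X⟧}
    (hG : IsGraded G) (gs : List (ℕ × ℕ × ℕ)) (hgs : ∀ g ∈ gs, PackedIn n (G g.1 g.2.1) g.2.2)
    {m m' s f : ℕ} (hm : m + m' = M) (hf : PackedIn n (G m s) f) :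
    ∀ N ∈ monomials n gs m' s f, PackedIn n (G M 0) N := by
  induction gs generalizing m m' s f with
  | nil =>
    intro N hN
    rw [monomials] at hN
    split_ifs at hN with h
    · rw [List.mem_singleton] at hN
      obtain ⟨F, hF, rfl⟩ := hf
      subst hN
      obtain rfl : m = M := by omega
      exact ⟨F, hG.even hF h.2, rfl⟩
    · simp at hN
  | cons g gs ih =>
    have ih' := @ih fun g' h' => hgs g' (by simp [h'])
    have key : ∀ c m m' s f, m + m' = M → PackedIn n (G m s) f →
        ∀ N ∈ monomialsStep n g.1 g.2.1 g.2.2 (monomials n gs) c m' s f,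
          PackedIn n (G M 0) N := by
      intro c
      induction c with
      | zero =>
        intro m m' s f hm hf N hN
        exact ih' hm hf N hN
      | succ c ihc =>
        intro m m' s f hm hf N hN
        rw [monomialsStep, List.mem_append] at hN
        rcases hN with hN | hN
        · exact ih' hm hf N hN
        · split_ifs at hN with hle
          · refine ihc (m + g.1) (m' - g.1) (s + g.2.1) _ (by omega) ?_ N hN
            obtain ⟨F, hF, rfl⟩ := hf
            obtain ⟨E, hE, hE'⟩ := hgs g (by simp)
            exact ⟨F * E, hG.mul_mem hF hE, by rw [hE', normalize_mul_pack hn]⟩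
          · simp at hN
    exact key _ _ _ _ _ hm hf

theorem exists_pivot_of_allPivots {n : ℕ} {W : AddSubgroup ℤ⟦X⟧} {l : List (ℕ × ℕ)}
    (hl : ∀ q ∈ l, PackedIn n W q.2) (h : allPivots n l = true) {i : ℕ} (hi : i < n) :
    ∃ F ∈ W, ((coeff i F : ℤ) : ZMod modulus) = 1 ∧
      ∀ j < i, ((coeff j F : ℤ) : ZMod modulus) = 0 := by
  simp only [allPivots, List.all_eq_true, List.mem_range, List.any_eq_true,
    decide_eq_true_eq] at h
  obtain ⟨q, hq, hqi⟩ := h i hi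
  obtain ⟨F, hF, hqF⟩ := hl q hq
  have hdig : ∀ j < n, q.2 / base ^ j % base = (coeff j F % (modulus : ℤ)).toNat := by
    intro j hj
    rw [hqF, pack, packFn_eq_sum]
    exact digit_of_sum (d := fun j => (coeff j F % (modulus : ℤ)).toNat)
      (fun k => (digit_lt _).trans (by norm_num [modulus, base])) hj
  obtain ⟨R, hR⟩ : ∃ R, q.2 = base ^ i + base ^ (i + 1) * R :=
    ⟨q.2 / base ^ (i + 1), by rw [← hqi, Nat.mod_add_div]⟩
  refine ⟨F, hF, ?_, fun j hj => ?_⟩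
  · rw [← digit_cast, ← hdig i hi, hR, pow_succ, mul_assoc, ← mul_one_add,
      Nat.mul_div_cancel_left _ (pow_pos base_pos i), Nat.add_mul_mod_self_left,
      Nat.mod_eq_of_lt (by norm_num [base]), Nat.cast_one]
  · rw [← digit_cast, ← hdig j (by omega), hR]
    obtain ⟨u, rfl⟩ : ∃ u, i = j + (u + 1) := ⟨i - j - 1, by omega⟩
    have : base ^ (j + (u + 1)) + base ^ (j + (u + 1) + 1) * R =
        base ^ j * (base * (base ^ u + base ^ (u + 1) * R)) := by ring
    rw [this, Nat.mul_div_cancel_left _ (pow_pos base_pos j), Nat.mul_mod_right, Nat.cast_zero]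

theorem hasOrder_of_pivots {K : Type*} [Field K] [CharZero K] {n : ℕ} (V : Submodule K K⟦X⟧)
    (h : ∀ i < n, ∃ F : ℤ⟦X⟧, F.map (Int.castRingHom K) ∈ V ∧
      ((coeff i F : ℤ) : ZMod modulus) = 1 ∧ ∀ j < i, ((coeff j F : ℤ) : ZMod modulus) = 0)
    {i : ℕ} (hi : i < n) : HasOrder V i := by
  choose F hF h1 h0 using fun i : Fin n => h i i.2
  let A : Matrix (Fin n) (Fin n) ℤ := Matrix.of fun i j => coeff (j : ℕ) (F i)
  have hA : A.det ≠ 0 := by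
    intro hA
    have hmod : (A.map (Int.castRingHom (ZMod modulus))).det = 1 := by
      rw [Matrix.det_of_isUpperTriangular]
      · exact Finset.prod_eq_one fun i _ => h1 i
      · intro i j hij
        exact h0 i j hij
    rw [← RingHom.mapMatrix_apply, ← RingHom.map_det, hA, map_zero] at hmod
    have : Fact (1 < modulus) := ⟨by norm_num [modulus]⟩
    exact zero_ne_one hmod
  let B : Matrix (Fin n) (Fin n) K := A.map (Int.castRingHom K)
  have hB : IsUnit B.det := by
    rw [isUnit_iff_ne_zero]
    change (A.map (Int.castRingHom K)).det ≠ 0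
    rw [← RingHom.mapMatrix_apply, ← RingHom.map_det]
    simpa using hA
  have hinv : ∀ j : Fin n, coeff (j : ℕ) (∑ k, B⁻¹ ⟨i, hi⟩ k • (F k).map (Int.castRingHom K)) =
      if i = j then 1 else 0 := by
    intro j
    have := congrFun (congrFun (Matrix.nonsing_inv_mul B hB) ⟨i, hi⟩) j
    rw [Matrix.mul_apply, Matrix.one_apply] at this
    simp only [Fin.ext_iff] at this
    simpa [B, A] using this
  refine hasOrder_iff.2 ⟨_, V.sum_mem (t := Finset.univ) fun k _ =>
    V.smul_mem (B⁻¹ ⟨i, hi⟩ k) (hF k), ?_, ?_⟩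
  · rw [hinv ⟨i, hi⟩]
    simp
  · intro j hj
    rw [hinv ⟨j, by omega⟩]
    simp [hj.ne']

theorem hasOrder_of_rankCheck {K : Type*} [Field K] [CharZero K] {p m n : ℕ} (hn : n ≤ 900)
    (V : ℕ → ℕ → Submodule K K⟦X⟧) (hone : 1 ∈ V 0 0)
    (hmul : ∀ {m s m' s' E F}, E ∈ V m s → F ∈ V m' s' → E * F ∈ V (m + m') (s + s'))
    (heven : ∀ {m s F}, F ∈ V m s → s % 2 = 0 → F ∈ V m 0)
    (hgen : ∀ g ∈ generators p, (mk g.2.2).map (Int.castRingHom K) ∈ V g.1 g.2.1)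
    (h : rankCheck p m n = true) {i : ℕ} (hi : i < n) : HasOrder (V m 0) i := by
  let G : ℕ → ℕ → AddSubgroup ℤ⟦X⟧ := fun m s =>
    (V m s).toAddSubgroup.comap (map (Int.castRingHom K) : ℤ⟦X⟧ →+* K⟦X⟧).toAddMonoidHom
  have hmem : ∀ {m s F}, F ∈ G m s ↔ F.map (Int.castRingHom K) ∈ V m s := Iff.rfl
  have hG : IsGraded G := by
    refine ⟨?_, fun {m s m' s' E F} hE hF => ?_, fun {m s F} hF hs => ?_⟩
    · rw [hmem, map_one]; exact hone
    · rw [hmem, map_mul]; exact hmul hE hF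
    · exact heven hF hs
  have hp1 : 0 < n → PackedIn n (G 0 0) 1 := fun hn' => by
    refine ⟨1, hG.one_mem, ?_⟩
    rw [pack, packFn_eq_sum, Finset.sum_eq_single 0]
    · simp [modulus]
    · intro j _ hj
      simp [coeff_one, hj]
    · intro h0
      exact absurd (Finset.mem_range.2 hn') h0
  have hmon := packedIn_monomials (M := m) (by omega) hG
    ((generators p).map fun g => (g.1, g.2.1, packFn g.2.2 n)) (fun g hg => by
      obtain ⟨g', hg', rfl⟩ := List.mem_map.1 hg
      exact ⟨mk g'.2.2, hgen g' hg', by simp [pack]⟩) (m := 0) (m' := m) (by omega)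
      (hp1 (by omega))
  refine hasOrder_of_pivots (n := n) (V m 0) (fun i hi => ?_) hi
  exact exists_pivot_of_allPivots (W := G m 0) (packedIn_eliminate _
    (fun r hr => hmon r (List.mem_of_mem_take hr)) [] (by simp) (by simp; omega)) h hi

end Packed

open Filter Topology Manifold

/-- `F` is the `q`-expansion of `f`, with `q = exp (2πiτ)`, convergent on the whole of `ℍ`. -/
def HasQSeries (f : ℍ → ℂ) (F : PowerSeries ℂ) : Prop :=
  ∀ τ : ℍ, HasSum (fun n : ℕ ↦ F.coeff n * Function.Periodic.qParam 1 τ ^ n) (f τ)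

namespace HasQSeries

variable {f g : ℍ → ℂ} {F G : PowerSeries ℂ}

theorem summable_norm (hf : HasQSeries f F) {q : ℂ} (hq : ‖q‖ < 1) :
    Summable fun n : ℕ ↦ ‖F.coeff n * q ^ n‖ := by
  rcases eq_or_ne q 0 with rfl | hq0
  · exact summable_of_ne_finset_zero (s := {0}) fun n hn ↦ by
      simp [zero_pow (Finset.notMem_singleton.mp hn)]
  · have him := Function.Periodic.im_invQParam_pos_of_norm_lt_one one_pos hq hq0
    have := (hf ⟨_, him⟩).summable.norm
    simpa [Function.Periodic.qParam_right_inv one_ne_zero hq0] using this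

theorem hasFPowerSeriesOnBall (hf : HasQSeries f F) :
    HasFPowerSeriesOnBall (fun q ↦ ∑' n : ℕ, F.coeff n * q ^ n)
      (.ofScalars ℂ fun n ↦ F.coeff n) 0 1 where
  r_le := by
    refine le_of_forall_lt_imp_le_of_dense fun r hr ↦ ?_
    lift r to NNReal using hr.ne_top
    apply FormalMultilinearSeries.le_radius_of_summable
    simpa [norm_mul, mul_comm, mul_left_comm, mul_assoc] using
      hf.summable_norm (q := (r : ℂ)) (by simpa using hr)
  r_pos := by simp
  hasSum := by
    intro y hy
    rw [← ENNReal.coe_one, Metric.eball_coe, NNReal.coe_one, mem_ball_zero_iff] at hy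
    simpa [mul_comm] using (hf.summable_norm hy).of_norm.hasSum

theorem eq_tsum (hf : HasQSeries f F) (τ : ℍ) :
    f τ = ∑' n : ℕ, F.coeff n * Function.Periodic.qParam 1 τ ^ n := (hf τ).tsum_eq.symm

theorem tendsto (hf : HasQSeries f F) : Tendsto f atImInfty (𝓝 (F.coeff 0)) := by
  rw [funext hf.eq_tsum]
  have h := hf.hasFPowerSeriesOnBall.hasFPowerSeriesAt.continuousAt.tendsto.comp
    (qParam_tendsto_atImInfty one_pos)
  have h0 : ∑' n : ℕ, F.coeff n * (0 : ℂ) ^ n = F.coeff 0 := by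
    rw [tsum_eq_single 0 fun n hn ↦ by simp [zero_pow hn]]
    simp
  simpa only [h0, Function.comp_def] using h

theorem isBoundedAtImInfty (hf : HasQSeries f F) : IsBoundedAtImInfty f :=
  hf.tendsto.isBigO_one ℝ

theorem comp_ofComplex_eq (hf : HasQSeries f F) {z : ℂ} (hz : 0 < z.im) :
    (f ∘ ofComplex) z = ∑' n : ℕ, F.coeff n * Function.Periodic.qParam 1 z ^ n := by
  simp [ofComplex_apply_of_im_pos hz, hf.eq_tsum]

theorem mdifferentiable (hf : HasQSeries f F) : MDiff f := by
  rw [mdifferentiable_iff]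
  have hd : DifferentiableOn ℂ (fun q : ℂ ↦ ∑' n : ℕ, F.coeff n * q ^ n) (Metric.ball 0 1) := by
    have := hf.hasFPowerSeriesOnBall.differentiableOn
    rwa [← ENNReal.coe_one, Metric.eball_coe, NNReal.coe_one] at this
  refine DifferentiableOn.congr (hd.comp (f := fun z ↦ Function.Periodic.qParam 1 z)
    (s := {z : ℂ | 0 < z.im}) (Function.Periodic.differentiable_qParam.differentiableOn)
    fun z hz ↦ ?_) fun z hz ↦ hf.comp_ofComplex_eq hz
  simpa using Function.Periodic.norm_qParam_lt_one one_pos hz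

theorem periodic (hf : HasQSeries f F) : Function.Periodic (f ∘ ofComplex) (1 : ℝ) := by
  intro z
  by_cases hz : 0 < z.im
  · have hq : Function.Periodic.qParam 1 (z + (1 : ℝ)) = Function.Periodic.qParam 1 z := by
      simp [Function.Periodic.qParam, mul_add, Complex.exp_add, Complex.exp_two_pi_mul_I]
    rw [hf.comp_ofComplex_eq hz, hf.comp_ofComplex_eq (z := z + (1 : ℝ)) (by simpa using hz), hq]
  · have h1 : z.im ≤ 0 := not_lt.mp hz
    simp [ofComplex_apply_of_im_nonpos h1,
      ofComplex_apply_of_im_nonpos (w := z + 1) (by simpa using h1)]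

theorem of_periodic (hf : Function.Periodic (f ∘ ofComplex) (1 : ℝ)) (hd : MDiff f)
    (hb : IsBoundedAtImInfty f) : HasQSeries f (qExpansion 1 f) :=
  fun τ ↦ by simpa only [smul_eq_mul] using UpperHalfPlane.hasSum_qExpansion one_pos hf hd hb τ

theorem eq_qExpansion (hf : HasQSeries f F) : F = qExpansion 1 f := by
  ext n
  exact @qExpansion_coeff_unique (ℍ → ℂ) ⟨fun f ↦ f, fun _ _ h ↦ h⟩ 1 f (fun n ↦ F.coeff n) one_pos
    (analyticAt_cuspFunction_zero one_pos hf.periodic hf.mdifferentiable hf.isBoundedAtImInfty)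
    (fun τ ↦ by simpa using hf τ) n

theorem unique (hf : HasQSeries f F) (hg : HasQSeries f G) : F = G :=
  hf.eq_qExpansion.trans hg.eq_qExpansion.symm

theorem ext (hf : HasQSeries f F) (hg : HasQSeries g F) : f = g :=
  funext fun τ ↦ (hf τ).unique (hg τ)

theorem add (hf : HasQSeries f F) (hg : HasQSeries g G) : HasQSeries (f + g) (F + G) :=
  fun τ ↦ by simpa [add_mul] using (hf τ).add (hg τ)

theorem smul (c : ℂ) (hf : HasQSeries f F) : HasQSeries (c • f) (c • F) :=
  fun τ ↦ by simpa [mul_assoc] using (hf τ).mul_left c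

theorem zero : HasQSeries 0 0 := fun τ ↦ by simp

theorem one : HasQSeries 1 1 := fun τ ↦ by
  have := hasSum_ite_eq (0 : ℕ) (1 : ℂ)
  convert! this using 2 with n
  by_cases hn : n = 0 <;> simp [PowerSeries.coeff_one, hn]

theorem mul (hf : HasQSeries f F) (hg : HasQSeries g G) : HasQSeries (f * g) (F * G) := by
  intro τ
  have hq := Function.Periodic.norm_qParam_lt_one one_pos τ.im_pos
  have h1 := hf.summable_norm hq
  have h2 := hg.summable_norm hq
  have h3 := (summable_norm_sum_mul_antidiagonal_of_summable_norm h1 h2).of_norm.hasSum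
  rw [← tsum_mul_tsum_eq_tsum_sum_antidiagonal_of_summable_norm h1 h2, ← hf.eq_tsum,
    ← hg.eq_tsum] at h3
  convert! h3 using 2 with n
  rw [PowerSeries.coeff_mul, Finset.sum_mul]
  refine Finset.sum_congr rfl fun x hx ↦ ?_
  rw [← Finset.HasAntidiagonal.mem_antidiagonal.mp hx, pow_add]
  ring

theorem shift {N : ℕ} (hf : HasQSeries f (PowerSeries.X ^ N * F)) :
    HasQSeries (fun τ ↦ f τ / Function.Periodic.qParam 1 τ ^ N) F := by
  intro τ
  have hq : Function.Periodic.qParam 1 (τ : ℂ) ^ N ≠ 0 :=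
    pow_ne_zero _ (Function.Periodic.qParam_ne_zero _)
  have h := hf τ
  rw [← hasSum_nat_add_iff' N] at h
  have h0 : ∑ i ∈ Finset.range N, (PowerSeries.X ^ N * F).coeff i *
      Function.Periodic.qParam 1 (τ : ℂ) ^ i = 0 := by
    refine Finset.sum_eq_zero fun i hi ↦ ?_
    rw [PowerSeries.coeff_X_pow_mul', if_neg (by simpa using hi), zero_mul]
  rw [h0, sub_zero] at h
  convert! h.div_const (Function.Periodic.qParam 1 (τ : ℂ) ^ N) using 2 with n
  rw [add_comm n N, PowerSeries.coeff_X_pow_mul' , if_pos (by omega), pow_add]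
  simp only [add_tsub_cancel_left]
  field_simp

theorem div_of_coeff_ne_zero (hf : HasQSeries f F) (hg : HasQSeries g G) (h0 : G.coeff 0 ≠ 0)
    (hne : ∀ τ, g τ ≠ 0) : ∃ H, HasQSeries (fun τ ↦ f τ / g τ) H := by
  refine ⟨_, of_periodic ?_ ?_ ?_⟩
  · intro z
    have h1 := hf.periodic z
    have h2 := hg.periodic z
    simp only [Function.comp_apply] at h1 h2 ⊢
    rw [h1, h2]
  · have h1 := hf.mdifferentiable
    have h2 := hg.mdifferentiable
    rw [mdifferentiable_iff] at h1 h2 ⊢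
    exact h1.div h2 fun z _ ↦ hne _
  · exact (hf.tendsto.div hg.tendsto h0).isBigO_one ℝ

/-- Division of `q`-series by a nowhere vanishing function whose `q`-series has order `N`. -/
theorem exists_div {N : ℕ} (hf : HasQSeries f (PowerSeries.X ^ N * F))
    (hg : HasQSeries g (PowerSeries.X ^ N * G)) (h0 : G.coeff 0 ≠ 0) (hne : ∀ τ, g τ ≠ 0) :
    ∃ H, HasQSeries (fun τ ↦ f τ / g τ) H := by
  have hq (τ : ℍ) : Function.Periodic.qParam 1 (τ : ℂ) ^ N ≠ 0 :=
    pow_ne_zero _ (Function.Periodic.qParam_ne_zero _)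
  obtain ⟨H, hH⟩ := hf.shift.div_of_coeff_ne_zero hg.shift h0 fun τ ↦ div_ne_zero (hne τ) (hq τ)
  refine ⟨H, ?_⟩
  convert! hH using 2 with τ
  have := hne τ
  have := hq τ
  field_simp

end HasQSeries

/-- The point `n τ` of the upper half plane. -/
def scalePoint {n : ℕ} (hn : 0 < n) (τ : ℍ) : ℍ :=
  ⟨n * τ, by simpa using mul_pos (Nat.cast_pos.mpr hn) τ.im_pos⟩

theorem coe_scalePoint {n : ℕ} (hn : 0 < n) (τ : ℍ) : (scalePoint hn τ : ℂ) = n * τ := rfl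

theorem HasQSeries.scale {f : ℍ → ℂ} {F : PowerSeries ℂ} (hf : HasQSeries f F) {n : ℕ}
    (hn : 0 < n) : HasQSeries (fun τ ↦ f (scalePoint hn τ))
      (.mk fun i ↦ if i % n = 0 then F.coeff (i / n) else 0) := by
  intro τ
  have hinj : Function.Injective (fun i : ℕ ↦ n * i) := fun a b h ↦ Nat.eq_of_mul_eq_mul_left hn h
  rw [← hinj.hasSum_iff]
  · convert! hf (scalePoint hn τ) using 2 with i
    simp only [Function.comp_apply, PowerSeries.coeff_mk, Nat.mul_mod_right, if_true,
      Nat.mul_div_cancel_left i hn]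
    congr 1
    rw [pow_mul]
    congr 1
    rw [Function.Periodic.qParam, Function.Periodic.qParam, ← Complex.exp_nat_mul, coe_scalePoint]
    congr 1
    ring
  · intro i hi
    have : i % n ≠ 0 := fun h ↦ hi ⟨i / n, Nat.mul_div_cancel' (Nat.dvd_of_mod_eq_zero h)⟩
    simp [this]

/-- Invariance of weight `2 * m` under `Γ₀(p)`, and under the Fricke involution up to `(-1) ^ s`. -/
structure IsFricke (p m s : ℕ) (f : ℍ → ℂ) : Prop where
  invariant : ∀ γ ∈ Gamma0 p, ∀ τ : ℍ,
    f (γ • τ) = ((γ 1 0 : ℂ) * τ + γ 1 1) ^ (2 * m) * f τ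
  fricke : ∀ τ w : ℍ, (w : ℂ) = -1 / (p * τ) → f w = (-1) ^ s * p ^ m * (τ : ℂ) ^ (2 * m) * f τ

/-- The `q`-expansions of the functions satisfying `IsFricke p m s`. -/
noncomputable def frickeSeries (p m s : ℕ) : Submodule ℂ (PowerSeries ℂ) where
  carrier := {F | ∃ f, IsFricke p m s f ∧ HasQSeries f F}
  zero_mem' := ⟨0, ⟨by simp, by simp⟩, HasQSeries.zero⟩
  add_mem' := by
    rintro F G ⟨f, hf, hF⟩ ⟨g, hg, hG⟩
    refine ⟨f + g, ⟨fun γ hγ τ ↦ ?_, fun τ w h ↦ ?_⟩, hF.add hG⟩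
    · simp only [Pi.add_apply, hf.invariant γ hγ, hg.invariant γ hγ, mul_add]
    · simp only [Pi.add_apply, hf.fricke τ w h, hg.fricke τ w h, mul_add]
  smul_mem' := by
    rintro c F ⟨f, hf, hF⟩
    refine ⟨c • f, ⟨fun γ hγ τ ↦ ?_, fun τ w h ↦ ?_⟩, hF.smul c⟩
    · simp only [Pi.smul_apply, hf.invariant γ hγ, smul_eq_mul]
      ring
    · simp only [Pi.smul_apply, hf.fricke τ w h, smul_eq_mul]
      ring

theorem one_mem_frickeSeries (p : ℕ) : 1 ∈ frickeSeries p 0 0 :=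
  ⟨1, ⟨by simp, by simp⟩, HasQSeries.one⟩

theorem mul_mem_frickeSeries {p m s m' s' : ℕ} {F G : PowerSeries ℂ} (hF : F ∈ frickeSeries p m s)
    (hG : G ∈ frickeSeries p m' s') : F * G ∈ frickeSeries p (m + m') (s + s') := by
  obtain ⟨f, hf, hF⟩ := hF
  obtain ⟨g, hg, hG⟩ := hG
  refine ⟨f * g, ⟨fun γ hγ τ ↦ ?_, fun τ w h ↦ ?_⟩, hF.mul hG⟩
  · simp only [Pi.mul_apply, hf.invariant γ hγ, hg.invariant γ hγ]
    ring
  · simp only [Pi.mul_apply, hf.fricke τ w h, hg.fricke τ w h]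
    ring

theorem mem_frickeSeries_of_even {p m s : ℕ} {F : PowerSeries ℂ} (hF : F ∈ frickeSeries p m s)
    (hs : s % 2 = 0) : F ∈ frickeSeries p m 0 := by
  obtain ⟨f, hf, hF⟩ := hF
  refine ⟨f, ⟨hf.invariant, fun τ w h ↦ ?_⟩, hF⟩
  rw [hf.fricke τ w h, (Nat.even_iff.mpr hs).neg_one_pow, pow_zero]

theorem coe_specialLinearGroup_smul (γ : SL(2, ℤ)) (τ : ℍ) :
    ((γ • τ : ℍ) : ℂ) = ((γ 0 0 : ℂ) * τ + γ 0 1) / ((γ 1 0 : ℂ) * τ + γ 1 1) := by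
  simp [UpperHalfPlane.specialLinearGroup_apply]

theorem specialLinearGroup_denom_ne_zero (γ : SL(2, ℤ)) (τ : ℍ) : (γ 1 0 : ℂ) * τ + γ 1 1 ≠ 0 := by
  have := UpperHalfPlane.denom_ne_zero (γ : GL (Fin 2) ℝ) τ
  simpa [UpperHalfPlane.denom] using this

/-- Conjugation by `τ ↦ p τ` takes `Γ₀(p)` into `SL(2, ℤ)`. -/
theorem exists_scalePoint_smul {p : ℕ} (hp : 0 < p) {γ : SL(2, ℤ)} (hγ : γ ∈ Gamma0 p) :
    ∃ γ' : SL(2, ℤ), (p : ℂ) * γ' 1 0 = γ 1 0 ∧ γ' 1 1 = γ 1 1 ∧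
      ∀ τ, scalePoint hp (γ • τ) = γ' • scalePoint hp τ := by
  rw [Gamma0_mem, ZMod.intCast_zmod_eq_zero_iff_dvd] at hγ
  obtain ⟨c, hc⟩ := hγ
  have hdet := γ.det_coe
  rw [Matrix.det_fin_two, hc] at hdet
  have hpc : (p : ℂ) * c = γ 1 0 := by exact_mod_cast hc.symm
  obtain ⟨γ', h00, h01, h10, h11⟩ : ∃ γ' : SL(2, ℤ),
      γ' 0 0 = γ 0 0 ∧ γ' 0 1 = p * γ 0 1 ∧ γ' 1 0 = c ∧ γ' 1 1 = γ 1 1 :=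
    ⟨⟨!![γ 0 0, p * γ 0 1; c, γ 1 1], by rw [Matrix.det_fin_two_of]; linarith⟩, rfl, rfl, rfl, rfl⟩
  refine ⟨γ', by rw [h10, hpc], h11, fun τ ↦ UpperHalfPlane.ext ?_⟩
  rw [coe_specialLinearGroup_smul, coe_scalePoint, coe_specialLinearGroup_smul, coe_scalePoint, h00,
    h01, h10, h11, ← hpc]
  push_cast
  ring

/-- Invariance of weight `k` under `SL(2, ℤ)`. -/
def IsLevelOne (k : ℕ) (g : ℍ → ℂ) : Prop :=
  ∀ (γ : SL(2, ℤ)) (τ : ℍ), g (γ • τ) = ((γ 1 0 : ℂ) * τ + γ 1 1) ^ k * g τ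

theorem coe_S_smul (τ : ℍ) : ((ModularGroup.S • τ : ℍ) : ℂ) = -1 / τ := by
  rw [coe_specialLinearGroup_smul]
  simp [ModularGroup.S]

theorem eq_S_smul {p : ℕ} (hp : 0 < p) {τ w : ℍ} (h : (w : ℂ) = -1 / (p * τ)) :
    w = ModularGroup.S • scalePoint hp τ := by
  apply UpperHalfPlane.ext
  rw [coe_S_smul, coe_scalePoint, h]

theorem scalePoint_eq_S_smul {p : ℕ} (hp : 0 < p) {τ w : ℍ} (h : (w : ℂ) = -1 / (p * τ)) :
    scalePoint hp w = ModularGroup.S • τ := by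
  apply UpperHalfPlane.ext
  have : (p : ℂ) ≠ 0 := by exact_mod_cast hp.ne'
  have := τ.ne_zero
  rw [coe_S_smul, coe_scalePoint, h]
  field_simp

namespace IsLevelOne

variable {k : ℕ} {g : ℍ → ℂ}

theorem apply_S_smul (hg : IsLevelOne k g) (τ : ℍ) :
    g (ModularGroup.S • τ) = (τ : ℂ) ^ k * g τ := by
  rw [hg]
  simp [ModularGroup.S]

theorem apply_scalePoint_smul (hg : IsLevelOne k g) {p : ℕ} (hp : 0 < p) {γ : SL(2, ℤ)}
    (hγ : γ ∈ Gamma0 p) (τ : ℍ) : g (scalePoint hp (γ • τ)) =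
      ((γ 1 0 : ℂ) * τ + γ 1 1) ^ k * g (scalePoint hp τ) := by
  obtain ⟨γ', h1, h2, h3⟩ := exists_scalePoint_smul hp hγ
  rw [h3, hg, ← h1, h2, coe_scalePoint]
  ring

theorem isFricke_add {m : ℕ} (hg : IsLevelOne (2 * m) g) {p : ℕ} (hp : 0 < p) (s : ℕ) :
    IsFricke p m s (g + ((-1) ^ s * p ^ m : ℂ) • fun τ ↦ g (scalePoint hp τ)) where
  invariant γ hγ τ := by
    simp only [Pi.add_apply, Pi.smul_apply, smul_eq_mul, hg γ τ, hg.apply_scalePoint_smul hp hγ τ]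
    ring
  fricke τ w h := by
    simp only [Pi.add_apply, Pi.smul_apply, smul_eq_mul]
    rw [scalePoint_eq_S_smul hp h, hg.apply_S_smul, eq_S_smul hp h, hg.apply_S_smul, coe_scalePoint]
    have : ((-1 : ℂ) ^ s) * (-1) ^ s = 1 := by rw [← mul_pow]; simp
    linear_combination (-(p : ℂ) ^ m * p ^ m * (τ : ℂ) ^ (2 * m) * g (scalePoint hp τ)) * this

theorem isFricke_mul {k : ℕ} (hg : IsLevelOne k g) {p : ℕ} (hp : 0 < p) :
    IsFricke p k 0 (g * fun τ ↦ g (scalePoint hp τ)) where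
  invariant γ hγ τ := by
    simp only [Pi.mul_apply, hg γ τ, hg.apply_scalePoint_smul hp hγ τ]
    ring
  fricke τ w h := by
    simp only [Pi.mul_apply]
    rw [scalePoint_eq_S_smul hp h, hg.apply_S_smul, eq_S_smul hp h, hg.apply_S_smul, coe_scalePoint]
    ring

theorem add_mem_frickeSeries {m : ℕ} (hg : IsLevelOne (2 * m) g) {G : PowerSeries ℂ}
    (hG : HasQSeries g G) {p : ℕ} (hp : 0 < p) (s : ℕ) :
    G + ((-1) ^ s * p ^ m : ℂ) • PowerSeries.mk (fun i ↦ if i % p = 0 then G.coeff (i / p) else 0) ∈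
      frickeSeries p m s :=
  ⟨_, hg.isFricke_add hp s, hG.add ((hG.scale hp).smul _)⟩

end IsLevelOne

/-- Division by a cusp form without zeros on the upper half plane. -/
theorem hasOrder_of_hasOrder_add {p : ℕ} (hp : 0 < p) {k : ℕ} {g : ℍ → ℂ} {G : PowerSeries ℂ}
    (hg : IsLevelOne k g) (hG : HasQSeries g G) (h1 : G.order = 1) (hne : ∀ τ, g τ ≠ 0) {m i : ℕ}
    (h : HasOrder (frickeSeries p (m + k) 0) (i + (p + 1))) : HasOrder (frickeSeries p m 0) i := by
  obtain ⟨F, ⟨f, hf, hF⟩, hFi⟩ := h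
  have hD := hG.mul (hG.scale hp)
  have hDk := hg.isFricke_mul hp
  set G' : PowerSeries ℂ := PowerSeries.mk fun i ↦ if i % p = 0 then G.coeff (i / p) else 0
  have hG' : G'.order = p := by
    rw [PowerSeries.order_eq_nat]
    rw [← Nat.cast_one, PowerSeries.order_eq_nat] at h1
    refine ⟨by simpa [G', Nat.div_self hp] using h1.1, fun j hj ↦ ?_⟩
    by_cases hj0 : j = 0
    · simpa [G', hj0] using h1.2 0 one_pos
    · simp [G', Nat.mod_eq_of_lt hj, hj0]
  have hDo : (G * G').order = (p + 1 : ℕ) := by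
    rw [PowerSeries.order_mul, h1, hG']
    push_cast
    ring
  obtain ⟨U, hU⟩ := PowerSeries.X_pow_dvd_iff.mpr fun j hj ↦
    (PowerSeries.order_eq_nat.mp hDo).2 j hj
  obtain ⟨V, hV⟩ := PowerSeries.X_pow_dvd_iff.mpr fun j (hj : j < p + 1) ↦
    (PowerSeries.order_eq_nat.mp hFi).2 j (by omega)
  have hU0 : U.coeff 0 ≠ 0 := by
    have := (PowerSeries.order_eq_nat.mp hDo).1
    rw [hU, PowerSeries.coeff_X_pow_mul', if_pos le_rfl] at this
    simpa using this
  have hDne (τ : ℍ) : (g * fun τ ↦ g (scalePoint hp τ)) τ ≠ 0 := mul_ne_zero (hne _) (hne _)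
  obtain ⟨H, hH⟩ := (hV ▸ hF).exists_div (hU ▸ hD) hU0 hDne
  set d : ℍ → ℂ := g * fun τ ↦ g (scalePoint hp τ)
  refine ⟨H, ⟨_, ⟨fun γ hγ τ ↦ ?_, fun τ w hw ↦ ?_⟩, hH⟩, ?_⟩
  · have := specialLinearGroup_denom_ne_zero γ τ
    rw [hf.invariant γ hγ, hDk.invariant γ hγ]
    have := hDne τ
    field_simp
    ring
  · have := τ.ne_zero
    have : (p : ℂ) ≠ 0 := by exact_mod_cast hp.ne'
    rw [hf.fricke τ w hw, hDk.fricke τ w hw]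
    have := hDne τ
    field_simp
    ring
  · have hmul : F = H * (G * G') := by
      refine hF.unique ?_
      convert! hH.mul hD using 1
      funext τ
      have := hDne τ
      simp only [Pi.mul_apply] at this ⊢
      field_simp
    rw [hmul, PowerSeries.order_mul, hDo] at hFi
    push_cast at hFi
    exact WithTop.add_right_cancel (by exact_mod_cast ENat.natCast_ne_top (p + 1)) hFi

namespace IsFricke

open scoped ModularForm

variable {p m : ℕ} {f : ℍ → ℂ} {F : PowerSeries ℂ}

theorem slash_eq_of_mem {s : ℕ} (hf : IsFricke p m s f) {γ : SL(2, ℤ)} (hγ : γ ∈ Gamma0 p) :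
    f ∣[(2 * m : ℤ)] γ = f := by
  funext τ
  rw [ModularForm.slash_action_eq'_iff, hf.invariant γ hγ]
  norm_cast

theorem apply_smul_of_notMem [Fact p.Prime] (hf : IsFricke p m 0 f) {γ : SL(2, ℤ)}
    (hγ : γ ∉ Gamma0 p) : ∃ j : ℤ, ∀ τ w : ℍ, (w : ℂ) = (τ + j) / p →
      f (γ • τ) = ((γ 1 0 : ℂ) * τ + γ 1 1) ^ (2 * m) * (((p : ℂ) ^ m)⁻¹ * f w) := by
  rw [Gamma0_mem] at hγ
  have hp0 : (p : ℂ) ≠ 0 := by exact_mod_cast (Fact.out : p.Prime).ne_zero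
  obtain ⟨j, hj⟩ := ZMod.intCast_surjective ((γ 1 1 : ZMod p) / (γ 1 0 : ZMod p))
  have hdet := γ.det_coe
  rw [Matrix.det_fin_two] at hdet
  obtain ⟨γ', h00, h01, h10, h11⟩ : ∃ γ' : SL(2, ℤ), γ' 0 0 = j * γ 0 0 - γ 0 1 ∧
      γ' 0 1 = γ 0 0 ∧ γ' 1 0 = j * γ 1 0 - γ 1 1 ∧ γ' 1 1 = γ 1 0 :=
    ⟨⟨!![j * γ 0 0 - γ 0 1, γ 0 0; j * γ 1 0 - γ 1 1, γ 1 0], by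
      rw [Matrix.det_fin_two_of]; linarith⟩, rfl, rfl, rfl, rfl⟩
  have hγ' : γ' ∈ Gamma0 p := by
    rw [Gamma0_mem, h10]
    push_cast
    rw [hj, div_mul_cancel₀ _ hγ, sub_self]
  refine ⟨j, fun τ w hw ↦ ?_⟩
  have hτj : (τ : ℂ) + j ≠ 0 := by
    intro h
    have := congrArg Complex.im h
    simp [τ.im_pos.ne'] at this
  have hwτ : (p : ℂ) * w = τ + j := by rw [hw]; field_simp
  have him : 0 < (-1 / (p * w : ℂ)).im := by
    have := (ModularGroup.S • scalePoint (Fact.out : p.Prime).pos w).im_pos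
    rwa [← UpperHalfPlane.coe_im, coe_S_smul, coe_scalePoint] at this
  have hmob : γ • τ = γ' • (⟨_, him⟩ : ℍ) := by
    apply UpperHalfPlane.ext
    have h1 := specialLinearGroup_denom_ne_zero γ τ
    have h2 := specialLinearGroup_denom_ne_zero γ' ⟨_, him⟩
    rw [coe_specialLinearGroup_smul, coe_specialLinearGroup_smul, div_eq_div_iff h1 h2]
    rw [h00, h01, h10, h11]
    simp only [hwτ]
    push_cast
    field_simp
    ring
  rw [hmob, hf.invariant γ' hγ', hf.fricke w ⟨_, him⟩ rfl, h10, h11]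
  simp only [hwτ]
  push_cast
  rw [show (γ 1 0 : ℂ) * τ + γ 1 1 = ((j * γ 1 0 - γ 1 1) * (-1 / ((τ : ℂ) + j)) + γ 1 0) *
    (τ + j) by field_simp; ring, ← hwτ, pow_zero, one_mul, mul_pow _ (_ * _) (2 * m),
    mul_pow _ _ (2 * m)]
  field_simp
  rw [← pow_mul, mul_comm m 2]
  ring

theorem tendsto_slash [Fact p.Prime] (hf : IsFricke p m 0 f) (hF : HasQSeries f F)
    (γ : SL(2, ℤ)) : ∃ c : ℝ, 0 < c ∧
      Tendsto (f ∣[(2 * m : ℤ)] γ) atImInfty (𝓝 (c * F.coeff 0)) := by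
  by_cases hγ : γ ∈ Gamma0 p
  · exact ⟨1, one_pos, by simpa [hf.slash_eq_of_mem hγ] using hF.tendsto⟩
  have hp0 : (0 : ℝ) < p := by exact_mod_cast (Fact.out : p.Prime).pos
  obtain ⟨j, hj⟩ := hf.apply_smul_of_notMem hγ
  have him (τ : ℍ) : ((τ + j) / p : ℂ).im = τ.im / p := by simp
  let w (τ : ℍ) : ℍ := ⟨(τ + j) / p, by rw [him]; exact div_pos τ.im_pos hp0⟩
  have hw : Tendsto w atImInfty atImInfty := by
    refine tendsto_comap_iff.mpr ?_
    have : UpperHalfPlane.im ∘ w = fun τ : ℍ ↦ τ.im / p := funext him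
    rw [this]
    exact tendsto_comap.atTop_div_const hp0
  refine ⟨((p : ℝ) ^ m)⁻¹, by positivity, ?_⟩
  have hslash : f ∣[(2 * m : ℤ)] γ = fun τ ↦ ((p : ℂ) ^ m)⁻¹ * f (w τ) := by
    funext τ
    have hd := specialLinearGroup_denom_ne_zero γ τ
    rw [ModularForm.SL_slash_apply, hj τ (w τ) rfl, mul_comm, ← mul_assoc]
    have : denom γ τ = (γ 1 0 : ℂ) * τ + γ 1 1 := by simp [denom]
    rw [this, _root_.zpow_neg, show (2 * m : ℤ) = (2 * m : ℕ) by push_cast; rfl, zpow_natCast,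
      inv_mul_cancel₀ (pow_ne_zero _ hd), one_mul]
  rw [hslash]
  have := (hF.tendsto.comp hw).const_mul ((p : ℂ) ^ m)⁻¹
  simpa using this

end IsFricke

section Equivalence

open scoped ModularForm

theorem HasQSeries.of_modularFormClass {Γ : Subgroup (GL (Fin 2) ℝ)} {k : ℤ} {𝓕 : Type*}
    [FunLike 𝓕 ℍ ℂ] [ModularFormClass 𝓕 Γ k] (h : (1 : ℝ) ∈ Γ.strictPeriods) (f : 𝓕) :
    HasQSeries f (qExpansion 1 f) :=
  have : Fact (IsCusp OnePoint.infty Γ) := ⟨Γ.isCusp_of_mem_strictPeriods one_pos h⟩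
  ModularForm.hasSum_qExpansion f one_pos h

theorem one_mem_strictPeriods_Gamma0 (p : ℕ) :
    (1 : ℝ) ∈ (Gamma0 p : Subgroup (GL (Fin 2) ℝ)).strictPeriods := by
  simp

theorem HasQSeries.of_modularFormClass_Gamma0 {p : ℕ} {k : ℤ} {𝓕 : Type*} [FunLike 𝓕 ℍ ℂ]
    [ModularFormClass 𝓕 (Gamma0 p) k] (f : 𝓕) : HasQSeries f (qExpansion 1 f) :=
  .of_modularFormClass (one_mem_strictPeriods_Gamma0 p) f

theorem IsFricke.of_slashInvariantFormClass {p m : ℕ} {𝓕 : Type*} [FunLike 𝓕 ℍ ℂ]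
    [SlashInvariantFormClass 𝓕 (Gamma0 p) (2 * m : ℤ)] {f : 𝓕}
    (hf : ∀ τ w : ℍ, (w : ℂ) = -1 / ((p : ℂ) * (τ : ℂ)) →
      f w = (p : ℂ) ^ ((2 * m : ℤ) / 2) * (τ : ℂ) ^ (2 * m : ℤ) * f τ) : IsFricke p m 0 f where
  invariant γ hγ τ := by
    have := SlashInvariantForm.slash_action_eqn_SL'' f hγ τ
    rw [this, show denom γ τ = (γ 1 0 : ℂ) * τ + γ 1 1 by simp [denom]]
    norm_cast
  fricke τ w h := by
    rw [hf τ w h, Int.mul_ediv_cancel_left _ two_ne_zero, pow_zero, one_mul]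
    norm_cast

namespace IsFricke

variable {p m : ℕ} {f : ℍ → ℂ} {F : PowerSeries ℂ}

/-- The modular form for `Γ₀(p)` attached to a Fricke invariant function with a `q`-expansion. -/
noncomputable def toModularForm [Fact p.Prime] (hf : IsFricke p m 0 f) (hF : HasQSeries f F) :
    ModularForm (Gamma0 p) (2 * m : ℤ) where
  toFun := f
  slash_action_eq' := by
    rintro _ ⟨γ, hγ, rfl⟩
    exact hf.slash_eq_of_mem hγ
  holo' := hF.mdifferentiable
  bdd_at_cusps' {c} hc := by
    rw [Subgroup.IsArithmetic.isCusp_iff_isCusp_SL2Z] at hc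
    rw [OnePoint.isBoundedAt_iff_forall_SL2Z hc]
    intro γ _
    obtain ⟨_, -, h⟩ := hf.tendsto_slash hF γ
    exact h.isBigO_one ℝ

/-- The cusp form for `Γ₀(p)` attached to a Fricke invariant function whose `q`-expansion has no
constant term. -/
noncomputable def toCuspForm [Fact p.Prime] (hf : IsFricke p m 0 f) (hF : HasQSeries f F)
    (h0 : F.coeff 0 = 0) : CuspForm (Gamma0 p) (2 * m : ℤ) where
  toFun := f
  slash_action_eq' := (hf.toModularForm hF).slash_action_eq'
  holo' := hF.mdifferentiable
  zero_at_cusps' {c} hc := by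
    rw [Subgroup.IsArithmetic.isCusp_iff_isCusp_SL2Z] at hc
    rw [OnePoint.isZeroAt_iff_forall_SL2Z hc]
    intro γ _
    obtain ⟨_, -, h⟩ := hf.tendsto_slash hF γ
    rw [h0, mul_zero] at h
    exact h

theorem fricke_zpow (hf : IsFricke p m 0 f) (τ w : ℍ) (h : (w : ℂ) = -1 / ((p : ℂ) * (τ : ℂ))) :
    f w = (p : ℂ) ^ ((2 * m : ℤ) / 2) * (τ : ℂ) ^ (2 * m : ℤ) * f τ := by
  rw [hf.fricke τ w h, Int.mul_ediv_cancel_left _ two_ne_zero, pow_zero, one_mul]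
  norm_cast

end IsFricke

/-- The `q`-expansion as a linear map on Fricke invariant modular forms. -/
noncomputable def frickeModularFormsQExpansion (p m : ℕ) [NeZero p] :
    frickeModularForms p (2 * m : ℤ) →ₗ[ℂ] PowerSeries ℂ where
  toFun f := qExpansion 1 (f : ModularForm (Gamma0 p) (2 * m : ℤ))
  map_add' f g := (HasQSeries.of_modularFormClass_Gamma0 (f + g).1).unique
    ((HasQSeries.of_modularFormClass_Gamma0 f.1).add (.of_modularFormClass_Gamma0 g.1))
  map_smul' c f := (HasQSeries.of_modularFormClass_Gamma0 (c • f).1).unique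
    ((HasQSeries.of_modularFormClass_Gamma0 f.1).smul c)

/-- The `q`-expansion as a linear map on Fricke invariant cusp forms. -/
noncomputable def frickeCuspFormsQExpansion (p m : ℕ) [NeZero p] :
    frickeCuspForms p (2 * m : ℤ) →ₗ[ℂ] PowerSeries ℂ where
  toFun f := qExpansion 1 (f : CuspForm (Gamma0 p) (2 * m : ℤ))
  map_add' f g := (HasQSeries.of_modularFormClass_Gamma0 (f + g).1).unique
    ((HasQSeries.of_modularFormClass_Gamma0 f.1).add (.of_modularFormClass_Gamma0 g.1))
  map_smul' c f := (HasQSeries.of_modularFormClass_Gamma0 (c • f).1).unique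
    ((HasQSeries.of_modularFormClass_Gamma0 f.1).smul c)

theorem finrank_frickeModularForms (p m : ℕ) [hp : Fact p.Prime] :
    Module.finrank ℂ (frickeModularForms p (2 * m : ℤ)) =
      Module.finrank ℂ (frickeSeries p m 0) := by
  have : NeZero p := ⟨hp.out.ne_zero⟩
  have hinj : Function.Injective (frickeModularFormsQExpansion p m) := by
    intro f g h
    have hg := HasQSeries.of_modularFormClass_Gamma0 g.1
    rw [← show qExpansion 1 f.1 = qExpansion 1 g.1 from h] at hg
    exact Subtype.ext (DFunLike.coe_injective ((HasQSeries.of_modularFormClass_Gamma0 f.1).ext hg))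
  have hrange : LinearMap.range (frickeModularFormsQExpansion p m) = frickeSeries p m 0 := by
    ext F
    constructor
    · rintro ⟨f, rfl⟩
      exact ⟨f.1, .of_slashInvariantFormClass f.2, .of_modularFormClass_Gamma0 f.1⟩
    · rintro ⟨f, hf, hF⟩
      exact ⟨⟨hf.toModularForm hF, hf.fricke_zpow⟩, hF.eq_qExpansion.symm⟩
  rw [← hrange]
  exact (LinearEquiv.ofInjective _ hinj).finrank_eq

theorem finrank_frickeCuspForms (p m : ℕ) [hp : Fact p.Prime] :
    Module.finrank ℂ (frickeCuspForms p (2 * m : ℤ)) =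
      Module.finrank ℂ (frickeSeries p m 0 ⊓ LinearMap.ker (PowerSeries.coeff (R := ℂ) 0) :
        Submodule ℂ (PowerSeries ℂ)) := by
  have : NeZero p := ⟨hp.out.ne_zero⟩
  have hinj : Function.Injective (frickeCuspFormsQExpansion p m) := by
    intro f g h
    have hg := HasQSeries.of_modularFormClass_Gamma0 g.1
    rw [← show qExpansion 1 f.1 = qExpansion 1 g.1 from h] at hg
    exact Subtype.ext (DFunLike.coe_injective ((HasQSeries.of_modularFormClass_Gamma0 f.1).ext hg))
  have hrange : LinearMap.range (frickeCuspFormsQExpansion p m) =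
      frickeSeries p m 0 ⊓ LinearMap.ker (PowerSeries.coeff (R := ℂ) 0) := by
    ext F
    constructor
    · rintro ⟨f, rfl⟩
      have : Fact (IsCusp OnePoint.infty (Gamma0 p : Subgroup (GL (Fin 2) ℝ))) :=
        ⟨Subgroup.isCusp_of_mem_strictPeriods one_pos (one_mem_strictPeriods_Gamma0 p)⟩
      have hF := HasQSeries.of_modularFormClass_Gamma0 f.1
      refine ⟨⟨f.1, IsFricke.of_slashInvariantFormClass f.2, hF⟩, ?_⟩
      exact tendsto_nhds_unique hF.tendsto (CuspFormClass.zero_at_infty f.1)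
    · rintro ⟨⟨f, hf, hF⟩, h0⟩
      exact ⟨⟨hf.toCuspForm hF h0, hf.fricke_zpow⟩, hF.eq_qExpansion.symm⟩
  rw [← hrange]
  exact (LinearEquiv.ofInjective _ hinj).finrank_eq

end Equivalence

section WeightTwo

open scoped ModularForm

/-- The trace to level one, where there are no forms of weight two, kills the constant term. -/
theorem coeff_zero_of_mem_frickeSeries_one {p : ℕ} [hp : Fact p.Prime] {F : PowerSeries ℂ}
    (hF : F ∈ frickeSeries p 1 0) : F.coeff 0 = 0 := by
  obtain ⟨f, hf, hF⟩ := hF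
  have : NeZero p := ⟨hp.out.ne_zero⟩
  let φ : ModularForm (Gamma0 p) 2 := hf.toModularForm hF
  let g : ModularForm 𝒮ℒ 2 := ModularForm.trace 𝒮ℒ φ
  have hg : (g : ℍ → ℂ) = 0 := by
    have := rank_zero_iff.mp ModularForm.levelOne_weight_two_rank_zero
    rw [Subsingleton.elim g 0]
    rfl
  let := Fintype.ofFinite (𝒮ℒ ⧸ (Gamma0 p : Subgroup (GL (Fin 2) ℝ)).subgroupOf 𝒮ℒ)
  have hsum : ∑ q, SlashInvariantForm.quotientFunc (ℋ := 𝒮ℒ) φ q = 0 := by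
    rw [← hg, ModularForm.coe_trace]
  have hlim (q : 𝒮ℒ ⧸ (Gamma0 p : Subgroup (GL (Fin 2) ℝ)).subgroupOf 𝒮ℒ) : ∃ c : ℝ, 0 < c ∧
      Tendsto (SlashInvariantForm.quotientFunc (ℋ := 𝒮ℒ) φ q) atImInfty (𝓝 (c * F.coeff 0)) := by
    induction q using Quotient.inductionOn with
    | h r =>
      obtain ⟨r, γ, rfl⟩ := r
      rw [SlashInvariantForm.quotientFunc_mk, ← map_inv]
      exact hf.tendsto_slash hF γ⁻¹
  choose c hc hlim using hlim
  have h := tendsto_finsetSum Finset.univ fun q _ ↦ hlim q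
  rw [← Finset.sum_mul] at h
  have h0 : Tendsto (fun τ : ℍ ↦ ∑ q, SlashInvariantForm.quotientFunc (ℋ := 𝒮ℒ) φ q τ)
      atImInfty (𝓝 0) := by
    simp only [← Finset.sum_apply, hsum, Pi.zero_apply]
    exact tendsto_const_nhds
  have : NeBot atImInfty := inferInstance
  have := tendsto_nhds_unique h h0
  rw [mul_eq_zero] at this
  refine this.resolve_left ?_
  rw [← Complex.ofReal_sum]
  exact_mod_cast (Finset.sum_pos (fun q _ ↦ hc q) Finset.univ_nonempty).ne'

end WeightTwo

section Generators

open EisensteinSeries ArithmeticFunction.sigma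
open scoped ModularForm

theorem IsLevelOne.of_slashInvariantFormClass {k : ℕ} {𝓕 : Type*} [FunLike 𝓕 ℍ ℂ]
    [SlashInvariantFormClass 𝓕 𝒮ℒ (k : ℤ)] (f : 𝓕) : IsLevelOne k f := fun γ τ ↦ by
  have := SlashInvariantForm.slash_action_eqn'' f (γ := (γ : GL (Fin 2) ℝ))
    (MonoidHom.mem_range.mpr ⟨γ, rfl⟩) τ
  simpa [UpperHalfPlane.denom, UpperHalfPlane.σ] using this

theorem sigma_eq_divisorPowSum (k n : ℕ) :
    ArithmeticFunction.sigma k n = Packed.divisorPowSum k n n := by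
  have h (d : ℕ) : Packed.divisorPowSum k n d = ∑ j ∈ Finset.range d,
      if n % (j + 1) = 0 then (j + 1) ^ k else 0 := by
    induction d with
    | zero => rfl
    | succ d ih => rw [Finset.sum_range_succ, Packed.divisorPowSum, ih]
  rw [ArithmeticFunction.sigma_apply, h, Nat.divisors, Finset.sum_filter,
    Finset.sum_Ico_eq_sum_range, Nat.add_sub_cancel]
  refine Finset.sum_congr rfl fun j _ ↦ ?_
  simp [add_comm, Nat.dvd_iff_mod_eq_zero]

theorem map_mk_eisensteinCoeff {p k : ℕ} {e u v : ℤ} {G : PowerSeries ℂ}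
    (hG : ∀ i, G.coeff i = if i = 0 then 1 else (e : ℂ) * ArithmeticFunction.sigma k i) :
    (PowerSeries.mk (Packed.eisensteinCoeff p k e u v)).map (Int.castRingHom ℂ) =
      (u : ℂ) • G + (v : ℂ) •
        PowerSeries.mk (fun i ↦ if i % p = 0 then G.coeff (i / p) else 0) := by
  ext i
  simp only [PowerSeries.coeff_map, PowerSeries.coeff_mk, map_add, PowerSeries.coeff_smul, hG,
    Packed.eisensteinCoeff, smul_eq_mul, eq_intCast]
  rcases eq_or_ne i 0 with rfl | hi
  · simp
  · by_cases hip : i % p = 0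
    · have hi' : i / p ≠ 0 := by
        intro h0
        have := Nat.div_add_mod i p
        rw [h0, hip] at this
        simp_all
      simp only [hi, hip, hi', if_true, if_false, sigma_eq_divisorPowSum]
      push_cast
      ring
    · simp only [hi, hip, if_false, sigma_eq_divisorPowSum]
      push_cast
      ring

theorem E2_smul (γ : SL(2, ℤ)) (τ : ℍ) : E2 (γ • τ) = ((γ 1 0 : ℂ) * τ + γ 1 1) ^ 2 * E2 τ -
    1 / (2 * riemannZeta 2) * (2 * Real.pi * Complex.I) * γ 1 0 * ((γ 1 0 : ℂ) * τ + γ 1 1) := by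
  have h := congrFun (E2_slash_action γ) τ
  have hd := specialLinearGroup_denom_ne_zero γ τ
  rw [ModularForm.SL_slash_apply, show denom γ τ = (γ 1 0 : ℂ) * τ + γ 1 1 by simp [denom]] at h
  simp only [Pi.sub_apply, Pi.smul_apply, D2, smul_eq_mul,
    show denom γ τ = (γ 1 0 : ℂ) * τ + γ 1 1 by simp [denom]] at h
  rw [_root_.zpow_neg, ← div_eq_mul_inv, div_eq_iff (zpow_ne_zero _ hd)] at h
  rw [h]
  set d := (γ 1 0 : ℂ) * τ + γ 1 1
  rw [show d ^ (2 : ℤ) = d ^ 2 by norm_cast]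
  field_simp

theorem E2_S_smul (τ : ℍ) : E2 (ModularGroup.S • τ) = (τ : ℂ) ^ 2 * E2 τ -
    1 / (2 * riemannZeta 2) * (2 * Real.pi * Complex.I) * τ := by
  rw [E2_smul]
  simp [ModularGroup.S]

theorem isFricke_E2 {p : ℕ} (hp : 0 < p) :
    IsFricke p 1 1 ((-1 : ℂ) • E2 + (p : ℂ) • fun τ ↦ E2 (scalePoint hp τ)) where
  invariant γ hγ τ := by
    obtain ⟨γ', h1, h2, h3⟩ := exists_scalePoint_smul hp hγ
    simp only [Pi.add_apply, Pi.smul_apply, smul_eq_mul]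
    rw [h3, E2_smul, E2_smul, ← h1, h2, coe_scalePoint]
    ring
  fricke τ w h := by
    simp only [Pi.add_apply, Pi.smul_apply, smul_eq_mul]
    rw [scalePoint_eq_S_smul hp h, eq_S_smul hp h, E2_S_smul, E2_S_smul, coe_scalePoint]
    ring

theorem hasQSeries_E2 : HasQSeries E2
    (.mk fun i ↦ if i = 0 then 1 else ((-24 : ℤ) : ℂ) * ArithmeticFunction.sigma 1 i) := fun τ ↦ by
  simpa [Function.Periodic.qParam] using hasSum_qExpansion_E2 (z := τ)

theorem coeff_qExpansion_E₄ (i : ℕ) : (qExpansion 1 ModularForm.E₄).coeff i =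
    if i = 0 then 1 else ((240 : ℤ) : ℂ) * ArithmeticFunction.sigma 3 i := by
  norm_num [E_qExpansion_coeff _ (⟨2, rfl⟩ : Even 4), show bernoulli 4 = -1 / 30 by decide +kernel]

theorem coeff_qExpansion_E₆ (i : ℕ) : (qExpansion 1 ModularForm.E₆).coeff i =
    if i = 0 then 1 else ((-504 : ℤ) : ℂ) * ArithmeticFunction.sigma 5 i := by
  norm_num [E_qExpansion_coeff _ (⟨3, rfl⟩ : Even 6), show bernoulli 6 = 1 / 42 by decide +kernel]

theorem generators_mem_frickeSeries {p : ℕ} (hp : 0 < p) :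
    ∀ g ∈ Packed.generators p,
      (PowerSeries.mk g.2.2).map (Int.castRingHom ℂ) ∈ frickeSeries p g.1 g.2.1 := by
  have h₄ (s : ℕ) := (IsLevelOne.of_slashInvariantFormClass (k := 2 * 2)
    ModularForm.E₄).add_mem_frickeSeries
    (.of_modularFormClass one_mem_strictPeriods_SL ModularForm.E₄) hp s
  have h₆ (s : ℕ) := (IsLevelOne.of_slashInvariantFormClass (k := 2 * 3)
    ModularForm.E₆).add_mem_frickeSeries
    (.of_modularFormClass one_mem_strictPeriods_SL ModularForm.E₆) hp s
  simp only [Packed.generators, List.forall_mem_cons, List.not_mem_nil, false_imp_iff,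
    implies_true, and_true, map_mk_eisensteinCoeff coeff_qExpansion_E₄,
    map_mk_eisensteinCoeff coeff_qExpansion_E₆]
  refine ⟨?_, by simpa using h₄ 0, by simpa using h₄ 1, by simpa using h₆ 0, by simpa using h₆ 1⟩
  rw [map_mk_eisensteinCoeff fun i ↦ PowerSeries.coeff_mk _ _]
  exact ⟨_, by simpa using isFricke_E2 hp,
    (hasQSeries_E2.smul _).add ((hasQSeries_E2.scale hp).smul _)⟩

theorem hasOrder_of_rankCheck {p m n i : ℕ} (hp : 0 < p) (hn : n ≤ 900)
    (h : Packed.rankCheck p m n = true) (hi : i < n) : HasOrder (frickeSeries p m 0) i :=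
  Packed.hasOrder_of_rankCheck hn (frickeSeries p) (one_mem_frickeSeries p) mul_mem_frickeSeries
    mem_frickeSeries_of_even (generators_mem_frickeSeries hp) h hi

theorem hasOrder_of_hasOrder_add_twelve {p m i : ℕ} (hp : 0 < p)
    (h : HasOrder (frickeSeries p (m + 12) 0) (i + (p + 1))) : HasOrder (frickeSeries p m 0) i :=
  hasOrder_of_hasOrder_add hp (.of_slashInvariantFormClass (k := 12) CuspForm.discriminant)
    (.of_modularFormClass one_mem_strictPeriods_SL CuspForm.discriminant)
    ModularForm.discriminant_qExpansion_order ModularForm.discriminant_ne_zero h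

end Generators

/-- The initial rank computations for the prime `p`, in weights `28`, `30` and `36`. -/
structure RankData (p a b c : ℕ) : Prop where
  prime : p.Prime
  le : p ≤ 500
  two_mul : 2 * c = p + 1
  add : 2 * a + b + 1 = c
  weight_four : Packed.rankCheck p 14 (a + p + 2) = true
  weight_six : Packed.rankCheck p 15 (b + p + 2) = true
  weight_twelve : c = 3 * a ∨ Packed.rankCheck p 18 (c + p + 2) = true

namespace RankData

variable {p a b c : ℕ}

theorem hasOrder (h : RankData p a b c) {m n i : ℕ} (hn : n ≤ c)
    (hr : Packed.rankCheck p (m + 12) (n + p + 2) = true) (hi : i ≤ n) :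
    HasOrder (frickeSeries p m 0) i := by
  have := h.le
  have := h.two_mul
  exact hasOrder_of_hasOrder_add_twelve h.prime.pos
    (hasOrder_of_rankCheck h.prime.pos (by omega) hr (by omega))

theorem hasOrder_iff (h : RankData p a b c) {m : ℕ} (hm : 2 ≤ m) (i : ℕ) :
    HasOrder (frickeSeries p m 0) i ↔ i ≤ maxOrder a b c m := by
  have : Fact p.Prime := ⟨h.prime⟩
  have hadd := h.add
  have hmul (m n i j : ℕ) (hi : HasOrder (frickeSeries p m 0) i)
      (hj : HasOrder (frickeSeries p n 0) j) : HasOrder (frickeSeries p (m + n) 0) (i + j) :=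
    hi.mul hj fun F hF G hG ↦ mul_mem_frickeSeries hF hG
  have h4 (i : ℕ) (hi : i ≤ a) : HasOrder (frickeSeries p 2 0) i :=
    h.hasOrder (by omega) h.weight_four hi
  refine order_iff_le_maxOrder (fun m i ↦ HasOrder (frickeSeries p m 0) i) hadd hmul ?_ ?_ h4
    (fun i hi ↦ h.hasOrder (by omega) h.weight_six hi) (fun i hi ↦ ?_) hm i
  · intro m i hi
    rw [h.two_mul] at hi
    exact hasOrder_of_hasOrder_add_twelve h.prime.pos hi
  · rintro ⟨F, hF, h0⟩
    exact (PowerSeries.order_eq_nat.mp h0).1 (coeff_zero_of_mem_frickeSeries_one hF)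
  · rcases h.weight_twelve with h3 | h12
    · obtain ⟨x, y, z, hx, hy, hz, rfl⟩ : ∃ x y z, x ≤ a ∧ y ≤ a ∧ z ≤ a ∧ i = x + y + z :=
        ⟨min i a, min (i - a) a, i - 2 * a, by omega, by omega, by omega, by omega⟩
      exact hmul 4 2 _ _ (hmul 2 2 _ _ (h4 x hx) (h4 y hy)) (h4 z hz)
    · exact h.hasOrder le_rfl h12 hi

theorem finrank_frickeModularForms (h : RankData p a b c) {m : ℕ} (hm : 2 ≤ m) :
    Module.finrank ℂ (frickeModularForms p (2 * m : ℤ)) = 1 + maxOrder a b c m := by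
  have : Fact p.Prime := ⟨h.prime⟩
  rw [_root_.finrank_frickeModularForms, finrank_eq_card_of_hasOrder _
    (Finset.range (maxOrder a b c m + 1)), Finset.card_range, add_comm]
  intro i
  rw [h.hasOrder_iff hm, Finset.mem_range, Nat.lt_succ_iff]

theorem finrank_frickeCuspForms (h : RankData p a b c) {m : ℕ} (hm : 2 ≤ m) :
    Module.finrank ℂ (frickeCuspForms p (2 * m : ℤ)) = maxOrder a b c m := by
  have : Fact p.Prime := ⟨h.prime⟩
  rw [_root_.finrank_frickeCuspForms, finrank_eq_card_of_hasOrder _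
    (Finset.Icc 1 (maxOrder a b c m)), Nat.card_Icc, Nat.add_sub_cancel]
  intro i
  rw [Finset.mem_Icc, ← h.hasOrder_iff hm]
  constructor
  · rintro ⟨F, ⟨hF, h0⟩, hi⟩
    refine ⟨Nat.one_le_iff_ne_zero.mpr ?_, F, hF, hi⟩
    rintro rfl
    exact (PowerSeries.order_eq_nat.mp hi).1 h0
  · rintro ⟨h1, F, hF, hi⟩
    exact ⟨F, ⟨hF, (PowerSeries.order_eq_nat.mp hi).2 0 h1⟩, hi⟩

end RankData

set_option maxRecDepth 100000 in
theorem rankData_five : RankData 5 1 0 3 :=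
  ⟨by norm_num, by norm_num, rfl, rfl, by decide +kernel, by decide +kernel, .inl rfl⟩

set_option maxRecDepth 100000 in
theorem rankData_seven : RankData 7 1 1 4 :=
  ⟨by norm_num, by norm_num, rfl, rfl, by decide +kernel, by decide +kernel,
    .inr (by decide +kernel)⟩

set_option maxRecDepth 100000 in
theorem rankData_eleven : RankData 11 2 1 6 :=
  ⟨by norm_num, by norm_num, rfl, rfl, by decide +kernel, by decide +kernel, .inl rfl⟩

set_option maxRecDepth 100000 in
theorem rankData_thirteen : RankData 13 2 2 7 :=
  ⟨by norm_num, by norm_num, rfl, rfl, by decide +kernel, by decide +kernel,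
    .inr (by decide +kernel)⟩

set_option maxRecDepth 100000 in
theorem rankData_seventeen : RankData 17 3 2 9 :=
  ⟨by norm_num, by norm_num, rfl, rfl, by decide +kernel, by decide +kernel, .inl rfl⟩

set_option maxRecDepth 100000 in
theorem rankData_nineteen : RankData 19 3 3 10 :=
  ⟨by norm_num, by norm_num, rfl, rfl, by decide +kernel, by decide +kernel,
    .inr (by decide +kernel)⟩

set_option maxRecDepth 100000 in
theorem rankData_twentyThree : RankData 23 4 3 12 :=
  ⟨by norm_num, by norm_num, rfl, rfl, by decide +kernel, by decide +kernel, .inl rfl⟩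

set_option maxRecDepth 100000 in
theorem rankData_twentyNine : RankData 29 5 4 15 :=
  ⟨by norm_num, by norm_num, rfl, rfl, by decide +kernel, by decide +kernel, .inl rfl⟩

set_option maxRecDepth 100000 in
theorem rankData_thirtyOne : RankData 31 5 5 16 :=
  ⟨by norm_num, by norm_num, rfl, rfl, by decide +kernel, by decide +kernel,
    .inr (by decide +kernel)⟩

set_option maxRecDepth 100000 in
theorem rankData_fortyOne : RankData 41 7 6 21 :=
  ⟨by norm_num, by norm_num, rfl, rfl, by decide +kernel, by decide +kernel, .inl rfl⟩

set_option maxRecDepth 100000 in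
theorem rankData_fortySeven : RankData 47 8 7 24 :=
  ⟨by norm_num, by norm_num, rfl, rfl, by decide +kernel, by decide +kernel, .inl rfl⟩

set_option maxRecDepth 100000 in
theorem rankData_fiftyNine : RankData 59 10 9 30 :=
  ⟨by norm_num, by norm_num, rfl, rfl, by decide +kernel, by decide +kernel, .inl rfl⟩

set_option maxRecDepth 100000 in
theorem rankData_seventyOne : RankData 71 12 11 36 :=
  ⟨by norm_num, by norm_num, rfl, rfl, by decide +kernel, by decide +kernel, .inl rfl⟩

theorem exists_rankData {p : ℕ}
    (hp : p ∈ ({5, 7, 11, 13, 17, 19, 23, 29, 31, 41, 47, 59, 71} : Set ℕ)) :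
    ∃ a b c, RankData p a b c ∧ if p % 12 = 1 ∨ p % 12 = 7 then p = 6 * a + 1 ∧ b = a
      else p + 1 = 6 * a ∧ a = b + 1 := by
  rcases hp with rfl | rfl | rfl | rfl | rfl | rfl | rfl | rfl | rfl | rfl | rfl | rfl | rfl
  · exact ⟨_, _, _, rankData_five, by simp⟩
  · exact ⟨_, _, _, rankData_seven, by simp⟩
  · exact ⟨_, _, _, rankData_eleven, by simp⟩
  · exact ⟨_, _, _, rankData_thirteen, by simp⟩
  · exact ⟨_, _, _, rankData_seventeen, by simp⟩
  · exact ⟨_, _, _, rankData_nineteen, by simp⟩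
  · exact ⟨_, _, _, rankData_twentyThree, by simp⟩
  · exact ⟨_, _, _, rankData_twentyNine, by simp⟩
  · exact ⟨_, _, _, rankData_thirtyOne, by simp⟩
  · exact ⟨_, _, _, rankData_fortyOne, by simp⟩
  · exact ⟨_, _, _, rankData_fortySeven, by simp⟩
  · exact ⟨_, _, _, rankData_fiftyNine, by simp⟩
  · exact ⟨_, _, _, rankData_seventyOne, by simp⟩

theorem exists_eq_six_mul_add (m : ℕ) : ∃ q r, r < 6 ∧ m = 6 * q + r :=
  ⟨m / 6, m % 6, by omega, by omega⟩

theorem six_mul_add_div {q r : ℕ} (hr : r < 6) : (6 * q + r) % 6 = r ∧ (6 * q + r) / 6 = q ∧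
    (6 * q + r) / 2 = 3 * q + r / 2 ∧ 2 * (6 * q + r) / 3 = 4 * q + 2 * r / 3 := by
  omega

theorem maxOrder_add_of_eq {a m : ℕ} (hm : 2 ≤ m) :
    maxOrder a a (3 * a + 1) m + m = (a + 1) * (m / 2) + 2 * m / 3 := by
  obtain ⟨q, r, hr, rfl⟩ := exists_eq_six_mul_add m
  obtain ⟨h1, h2, h3, h4⟩ := six_mul_add_div (q := q) hr
  rw [maxOrder, h1, h2, h3, h4]
  interval_cases r <;> norm_num only [if_true, if_false]
  on_goal 2 =>
    obtain ⟨q, rfl⟩ : ∃ n, q = n + 1 := ⟨q - 1, by omega⟩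
    zify [show 1 ≤ (q + 1) * (3 * a + 1) by nlinarith]
    ring
  all_goals ring

theorem maxOrder_add_of_eq_add_one {b m : ℕ} (hm : 2 ≤ m) :
    maxOrder (b + 1) b (3 * (b + 1)) m + m = (b + 3) * (m / 2) := by
  obtain ⟨q, r, hr, rfl⟩ := exists_eq_six_mul_add m
  obtain ⟨h1, h2, h3, h4⟩ := six_mul_add_div (q := q) hr
  rw [maxOrder, h1, h2, h3]
  interval_cases r <;> norm_num only [if_true, if_false]
  on_goal 2 =>
    obtain ⟨q, rfl⟩ : ∃ n, q = n + 1 := ⟨q - 1, by omega⟩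
    zify [show 1 ≤ (q + 1) * (3 * (b + 1)) by nlinarith]
    ring
  all_goals ring

/-- **Dimensions of spaces of Fricke-invariant cusp and modular forms** (Choi).
Let `p ∈ {5, 7, 11, 13, 17, 19, 23, 29, 31, 41, 47, 59, 71}` (the primes `p > 3` for which
`Γ₀⁺(p)` has genus zero) and let `k > 2` be even. Then
`dim S_k⁺(p) = ((p+5)/6)·⌊k/4⌋ + ⌊k/3⌋ − k/2` if `p ≡ 1, 7 (mod 12)`, and
`dim S_k⁺(p) = ((p+13)/6)·⌊k/4⌋ − k/2` if `p ≡ 5, 11 (mod 12)`; moreover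
`dim M_k⁺(p) = 1 + dim S_k⁺(p)`. -/
theorem dim_fricke_forms (p : ℕ)
    (hp : p ∈ ({5, 7, 11, 13, 17, 19, 23, 29, 31, 41, 47, 59, 71} : Set ℕ))
    (k : ℤ) (hk : 2 < k) (hke : Even k) :
    (Module.finrank ℂ (frickeCuspForms p k) : ℚ) =
      (if p % 12 = 1 ∨ p % 12 = 7 then
        ((p : ℚ) + 5) / 6 * (⌊(k : ℚ) / 4⌋ : ℚ) + (⌊(k : ℚ) / 3⌋ : ℚ) - (k : ℚ) / 2
      else
        ((p : ℚ) + 13) / 6 * (⌊(k : ℚ) / 4⌋ : ℚ) - (k : ℚ) / 2) ∧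
    Module.finrank ℂ (frickeModularForms p k) =
      1 + Module.finrank ℂ (frickeCuspForms p k) := by
  obtain ⟨m, rfl⟩ : ∃ m : ℕ, k = 2 * m := by
    obtain ⟨n, rfl⟩ := hke
    exact ⟨n.toNat, by omega⟩
  have hm : 2 ≤ m := by omega
  obtain ⟨a, b, c, h, hab⟩ := exists_rankData hp
  rw [h.finrank_frickeModularForms hm, h.finrank_frickeCuspForms hm]
  refine ⟨?_, rfl⟩
  have hc := h.add
  have h4 : ⌊((2 * m : ℤ) : ℚ) / 4⌋ = (m / 2 : ℕ) := by
    have := Rat.floor_intCast_div_natCast (2 * m) 4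
    push_cast at this ⊢
    rw [this]
    omega
  have h3 : ⌊((2 * m : ℤ) : ℚ) / 3⌋ = (2 * m / 3 : ℕ) := by
    have := Rat.floor_intCast_div_natCast (2 * m) 3
    push_cast at this ⊢
    exact this
  rw [h4, h3, Int.cast_natCast, Int.cast_natCast]
  split_ifs at hab ⊢
  · obtain ⟨rfl, rfl⟩ := hab
    obtain rfl : c = 3 * b + 1 := by omega
    have := congrArg (Nat.cast (R := ℚ)) (maxOrder_add_of_eq (a := b) hm)
    generalize m / 2 = x at *
    generalize 2 * m / 3 = y at *
    push_cast at this ⊢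
    linear_combination this
  · obtain ⟨hp6, rfl⟩ := hab
    obtain rfl : c = 3 * (b + 1) := by omega
    have h1 := congrArg (Nat.cast (R := ℚ)) (maxOrder_add_of_eq_add_one (b := b) hm)
    have h2 := congrArg (Nat.cast (R := ℚ)) hp6
    generalize m / 2 = x at *
    push_cast at h1 h2 ⊢
    linear_combination h1 - x / 6 * h2
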